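/- arXiv:2112.15205 — 4 statements merged into one kernel-verified Lean document; each statement's English description precedes it below -/
import Mathlib

section
/- On the free ℤ-module ℤ[Ω^∞] with basis the set of all marked compositions, the merge and insert operators are anticommuting differentials: (∂_M^∞)∘(∂_M^∞) = 0, (∂_I^∞)∘(∂_I^∞) = 0, and ∂_M^∞∘∂_I^∞ + ∂_I^∞∘∂_M^∞ = 0. -/
/-- A composition: a (possibly empty) list of positive integers. -/
abbrev Comp : Type := List PNat

/-- A marked composition: a composition together with a mark `κ : ℕ`. -/
abbrev MComp : Type := List PNat × ℕ

/-- The norm `|ω|` of a composition. -/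
def normC (ω : Comp) : ℕ := (ω.map fun a => (a : ℕ)).sum

/-- The reduced norm `|ω|' = |ω| - ℓ` of a composition. -/
def rnormC (ω : Comp) : ℕ := normC ω - ω.length

/-- The norm of a marked composition. -/
def normM (x : MComp) : ℕ := normC x.1 + x.2

/-- The reduced norm of a marked composition. -/
def rnormM (x : MComp) : ℕ := rnormC x.1 + x.2

/-- Merge the parts at (0-indexed) positions `k` and `k+1` of a composition. -/
def mergeAux : Comp → ℕ → Comp
  | a :: b :: t, 0 => (a + b) :: t
  | a :: t, n + 1 => a :: mergeAux t n
  | l, _ => l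

/-- The merge operation `M_k^∞` (`0 ≤ k ≤ ℓ`) on marked compositions:
`M_0^∞` moves the first part to the mark, `M_ℓ^∞` moves the last part to the mark, and
for `1 ≤ k ≤ ℓ-1`, `M_k^∞` merges the `k`-th and `(k+1)`-st parts (1-indexed). -/
def mergeM (x : MComp) (k : ℕ) : MComp :=
  if k = 0 then
    match x.1 with
    | [] => x
    | a :: t => (t, x.2 + (a : ℕ))
  else if k = x.1.length then
    match x.1.getLast? with
    | none => x
    | some a => (x.1.dropLast, x.2 + (a : ℕ))
  else (mergeAux x.1 (k - 1), x.2)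

/-- The insert operation `I_k` (`0 ≤ k ≤ ℓ`): insert a part `2` after the first `k` parts. -/
def insertC (ω : Comp) (k : ℕ) : Comp := ω.take k ++ (2 : PNat) :: ω.drop k

/-- The insert operation `I_k^∞` on marked compositions. -/
def insertM (x : MComp) (k : ℕ) : MComp := (insertC x.1 k, x.2)

/-- One merge or insert step on marked compositions: `mstep y x` means `x` is
obtained from `y` by a single operation. -/
def mstep (y x : MComp) : Prop :=
  (∃ k ≤ y.1.length, y.1 ≠ [] ∧ x = mergeM y k) ∨ ∃ k ≤ y.1.length, x = insertM y k

/-- `mprec x y` is the relation `x ⪯ y` on marked compositions. -/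
def mprec (x y : MComp) : Prop := Relation.ReflTransGen mstep y x

/-- One merge or insert step on compositions: merges `M_j`, `1 ≤ j ≤ ℓ-1`
(0-indexed: positions `k, k+1` with `k + 2 ≤ ℓ`), and all inserts. -/
def cstep (y x : Comp) : Prop :=
  (∃ k, k + 2 ≤ y.length ∧ x = mergeAux y k) ∨ ∃ k ≤ y.length, x = insertC y k

/-- `cprec x y` is the relation `x ⪯ y` on compositions. -/
def cprec (x y : Comp) : Prop := Relation.ReflTransGen cstep y x

/-- The value of the merge differential `∂_M^∞` on a basis element (it is `0` when `ℓ = 0`). -/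
noncomputable def dMval (x : MComp) : MComp →₀ ℤ :=
  if x.1.length = 0 then 0
  else -∑ k ∈ Finset.range (x.1.length + 1), Finsupp.single (mergeM x k) ((-1 : ℤ) ^ k)

/-- The value of the insert differential `∂_I^∞` on a basis element. -/
noncomputable def dIval (x : MComp) : MComp →₀ ℤ :=
  ∑ k ∈ Finset.range (x.1.length + 1), Finsupp.single (insertM x k) ((-1 : ℤ) ^ k)

/-- The merge differential `∂_M^∞` on `ℤ[Ω^∞]`. -/
noncomputable def dM : (MComp →₀ ℤ) →ₗ[ℤ] (MComp →₀ ℤ) :=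
  Finsupp.lsum ℤ fun x => LinearMap.toSpanSingleton ℤ (MComp →₀ ℤ) (dMval x)

/-- The insert differential `∂_I^∞` on `ℤ[Ω^∞]`. -/
noncomputable def dI : (MComp →₀ ℤ) →ₗ[ℤ] (MComp →₀ ℤ) :=
  Finsupp.lsum ℤ fun x => LinearMap.toSpanSingleton ℤ (MComp →₀ ℤ) (dIval x)

/-- Merge part `k` (0-indexed) with its right neighbour, the last part going to the mark. -/
def mergeE : List PNat → ℕ → List PNat × ℕ
  | [], _ => ([], 0)
  | [a], 0 => ([], (a : ℕ))
  | a :: b :: t, 0 => ((a + b) :: t, 0)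
  | a :: t, n + 1 => (a :: (mergeE t n).1, (mergeE t n).2)

theorem insertC_zero (l : List PNat) : insertC l 0 = 2 :: l := by simp [insertC]

theorem insertC_succ (a : PNat) (l : List PNat) (k : ℕ) :
    insertC (a :: l) (k + 1) = a :: insertC l k := by simp [insertC]

theorem insertC_length (l : List PNat) (k : ℕ) : (insertC l k).length = l.length + 1 := by
  simp [insertC]; omega

theorem mergeE_cons_succ (a : PNat) (t : List PNat) (n : ℕ) :
    mergeE (a :: t) (n + 1) = (a :: (mergeE t n).1, (mergeE t n).2) := by
  cases t <;> simp [mergeE]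

theorem mergeAux_cons_succ (a : PNat) (t : List PNat) (n : ℕ) :
    mergeAux (a :: t) (n + 1) = a :: mergeAux t n := by
  cases t <;> simp [mergeAux]

theorem mergeE_length (l : List PNat) (k : ℕ) (h : k < l.length) :
    (mergeE l k).1.length + 1 = l.length := by
  induction l generalizing k with
  | nil => simp at h
  | cons a t ih =>
    cases k with
    | zero => cases t <;> simp [mergeE]
    | succ k => 
      have := ih k (by simpa using h)
      simp [mergeE_cons_succ, this]

theorem mergeE_of_lt (l : List PNat) (k : ℕ) (h : k + 1 < l.length) :
    mergeE l k = (mergeAux l k, 0) := by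
  induction l generalizing k with
  | nil => simp at h
  | cons a t ih =>
    cases k with
    | zero => cases t <;> simp_all [mergeE, mergeAux]
    | succ k =>
      simp [mergeE_cons_succ, mergeAux_cons_succ, ih k (by simpa using h)]

theorem mergeE_last (l : List PNat) (a : PNat) :
    mergeE (l ++ [a]) l.length = (l, (a : ℕ)) := by
  induction l with
  | nil => simp [mergeE]
  | cons b t ih => simp [mergeE_cons_succ, ih]

theorem mergeM_zero (a : PNat) (t : List PNat) (c : ℕ) :
    mergeM (a :: t, c) 0 = (t, c + (a : ℕ)) := by simp [mergeM]

theorem mergeM_succ (l : List PNat) (c k : ℕ) (h : k < l.length) :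
    mergeM (l, c) (k + 1) = ((mergeE l k).1, c + (mergeE l k).2) := by
  by_cases hk : k + 1 = l.length
  · rcases List.eq_nil_or_concat l with rfl | ⟨t, a, rfl⟩
    · simp at h
    · have : k = t.length := by simpa using hk
      subst this
      simp [mergeM, mergeE_last]
  · rw [mergeE_of_lt l k (by omega)]
    simp [mergeM, hk]

theorem mergeM_length (x : MComp) (k : ℕ) (h : k ≤ x.1.length) (h0 : x.1.length ≠ 0) :
    (mergeM x k).1.length + 1 = x.1.length := by
  obtain ⟨l, c⟩ := x
  cases k with
  | zero => cases l with
    | nil => simp at h0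
    | cons a t => simp [mergeM_zero]
  | succ k => 
    rw [mergeM_succ _ _ _ h]
    exact mergeE_length l k h

theorem mergeE_comm (l : List PNat) (i j : ℕ) (hij : i ≤ j) (hj : j + 1 < l.length) :
    (mergeE (mergeE l (j + 1)).1 i).1 = (mergeE (mergeE l i).1 j).1 ∧
    (mergeE l (j + 1)).2 + (mergeE (mergeE l (j + 1)).1 i).2 =
      (mergeE l i).2 + (mergeE (mergeE l i).1 j).2 := by
  induction l generalizing i j with
  | nil => simp at hj
  | cons a t ih =>
    cases i with
    | zero =>
      cases t with
      | nil => simp at hj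
      | cons b t =>
        cases j with
        | zero => cases t <;> simp [mergeE, add_assoc] <;> omega
        | succ j => simp [mergeE_cons_succ, mergeE]
    | succ i =>
      obtain ⟨j, rfl⟩ : ∃ j', j = j' + 1 := ⟨j - 1, by omega⟩
      have := ih i j (by omega) (by simpa using hj)
      simp [mergeE_cons_succ, this]

theorem MM_comm (x : MComp) (i j : ℕ) (hij : i ≤ j) (hj : j + 1 ≤ x.1.length)
    (h2 : 2 ≤ x.1.length) :
    mergeM (mergeM x (j + 1)) i = mergeM (mergeM x i) j := by
  obtain ⟨l, c⟩ := x
  simp only at hj h2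
  cases i with
  | zero =>
    match l, h2 with
    | a :: b :: t, _ =>
    cases j with
    | zero => simp [mergeM_succ, mergeM_zero, mergeE, add_assoc]
    | succ j =>
      have hj' : j < (b :: t).length := by simpa using hj
      rw [mergeM_succ _ _ _ hj, mergeE_cons_succ, mergeM_zero, mergeM_zero,
        mergeM_succ _ _ _ hj']
      simp only [Prod.mk.injEq, true_and]; omega
  | succ i =>
    obtain ⟨j, rfl⟩ : ∃ j', j = j' + 1 := ⟨j - 1, by omega⟩
    have h := mergeE_comm l i j (by omega) (by omega)
    have h1 := mergeE_length l (j + 1) (by omega)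
    have h3 := mergeE_length l i (by omega)
    rw [mergeM_succ l c (j + 1) (by omega), mergeM_succ l c i (by omega),
      mergeM_succ _ _ _ (by omega), mergeM_succ _ _ _ (by omega), h.1, add_assoc, h.2, add_assoc]

theorem insertC_comm (l : List PNat) (i j : ℕ) (hij : i ≤ j) (hj : j ≤ l.length) :
    insertC (insertC l j) i = insertC (insertC l i) (j + 1) := by
  induction l generalizing i j with
  | nil =>
    obtain rfl : j = 0 := by simpa using hj
    obtain rfl : i = 0 := by omega
    simp [insertC]
  | cons a t ih =>
    cases i with
    | zero => simp [insertC_zero, insertC_succ]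
    | succ i =>
      obtain ⟨j, rfl⟩ : ∃ j', j = j' + 1 := ⟨j - 1, by omega⟩
      simp [insertC_succ, ih i j (by omega) (by simpa using hj)]

theorem EI_lt (l : List PNat) (k j : ℕ) (hk : k < j) (hj : j < l.length) :
    mergeE (insertC l (j + 1)) k = (insertC (mergeE l k).1 j, (mergeE l k).2) := by
  induction l generalizing k j with
  | nil => simp at hj
  | cons a t ih =>
    obtain ⟨j, rfl⟩ : ∃ j', j = j' + 1 := ⟨j - 1, by omega⟩
    cases k with
    | zero =>
      cases t with
      | nil => simp at hj
      | cons b t => simp [insertC_succ, mergeE]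
    | succ k =>
      simp [insertC_succ, mergeE_cons_succ, ih k j (by omega) (by simpa using hj)]

theorem EI_gt (l : List PNat) (k j : ℕ) (hk : j ≤ k) (hj : k < l.length) :
    mergeE (insertC l j) (k + 1) = (insertC (mergeE l k).1 j, (mergeE l k).2) := by
  induction l generalizing k j with
  | nil => simp at hj
  | cons a t ih =>
    cases j with
    | zero => simp [insertC_zero, mergeE_cons_succ]
    | succ j =>
      obtain ⟨k, rfl⟩ : ∃ j', k = j' + 1 := ⟨k - 1, by omega⟩
      simp [insertC_succ, mergeE_cons_succ, ih k j (by omega) (by simpa using hj)]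

theorem EI_eq (l : List PNat) (j : ℕ) (hj : j < l.length) :
    mergeE (insertC l (j + 1)) j = mergeE (insertC l j) j := by
  induction l generalizing j with
  | nil => simp at hj
  | cons a t ih =>
    cases j with
    | zero => simp [insertC_zero, insertC_succ, mergeE, add_comm]
    | succ j => simp [insertC_succ, mergeE_cons_succ, ih j (by simpa using hj)]

theorem MI_le (x : MComp) (k j : ℕ) (hk : k ≤ j) (hj : j < x.1.length) :
    mergeM (insertM x (j + 1)) k = insertM (mergeM x k) j := by
  obtain ⟨l, c⟩ := x
  simp only at hj
  cases k with
  | zero => cases l with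
    | nil => simp at hj
    | cons a t => simp [insertM, insertC_succ, mergeM_zero]
  | succ k =>
    simp only [insertM]
    rw [mergeM_succ _ _ _ (by rw [insertC_length]; omega), mergeM_succ _ _ _ (by omega),
      EI_lt l k j (by omega) hj]

theorem MI_gt (x : MComp) (k j : ℕ) (hk : j < k) (hj : k ≤ x.1.length) :
    mergeM (insertM x j) (k + 1) = insertM (mergeM x k) j := by
  obtain ⟨l, c⟩ := x
  simp only at hj
  obtain ⟨k, rfl⟩ : ∃ j', k = j' + 1 := ⟨k - 1, by omega⟩
  simp only [insertM]
  rw [mergeM_succ _ _ _ (by rw [insertC_length]; omega), mergeM_succ _ _ _ (by omega),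
      EI_gt l k j (by omega) (by omega)]

theorem MI_eq (x : MComp) (j : ℕ) (hj : j < x.1.length) :
    mergeM (insertM x (j + 1)) (j + 1) = mergeM (insertM x j) (j + 1) := by
  obtain ⟨l, c⟩ := x
  simp only at hj
  simp only [insertM]
  rw [mergeM_succ _ _ _ (by rw [insertC_length]; omega),
    mergeM_succ _ _ _ (by rw [insertC_length]; omega), EI_eq l j hj]

theorem MI_ends (x : MComp) :
    mergeM (insertM x 0) 0 = mergeM (insertM x x.1.length) (x.1.length + 1) := by
  obtain ⟨l, c⟩ := x
  simp only [insertM]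
  rw [mergeM_succ _ _ _ (by rw [insertC_length]; omega), insertC_zero, mergeM_zero]
  have : insertC l l.length = l ++ [2] := by simp [insertC]
  rw [this, mergeE_last]

theorem sum_simplicial {A : Type*} [AddCommGroup A] (n : ℕ) (F : ℕ → ℕ → A)
    (h : ∀ i j, i ≤ j → j < n → F i (j + 1) = F j i) :
    ∑ p ∈ Finset.range n ×ˢ Finset.range (n + 1), (-1 : ℤ) ^ (p.1 + p.2) • F p.1 p.2 = 0 := by
  refine Finset.sum_involution
    (fun p _ => if p.1 < p.2 then (p.2 - 1, p.1) else (p.2, p.1 + 1)) ?_ ?_ ?_ ?_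
  · rintro ⟨i, j⟩ hp
    simp only [Finset.mem_product, Finset.mem_range] at hp
    by_cases hij : i < j
    · obtain ⟨j, rfl⟩ : ∃ j', j = j' + 1 := ⟨j - 1, by omega⟩
      simp only [hij, if_true]
      rw [h i j (by omega) (by omega), Nat.add_sub_cancel, ← add_smul]
      rw [show (-1 : ℤ) ^ (i + (j + 1)) + (-1) ^ (j + i) = 0 by ring, zero_smul]
    · simp only [hij, if_false]
      rw [h j i (by omega) (by omega), ← add_smul]
      rw [show (-1 : ℤ) ^ (i + j) + (-1) ^ (j + (i + 1)) = 0 by ring, zero_smul]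
  · rintro ⟨i, j⟩ hp _
    by_cases hij : i < j
    · simp only [hij, if_true, ne_eq, Prod.mk.injEq]; omega
    · simp only [hij, if_false, ne_eq, Prod.mk.injEq]; omega
  · rintro ⟨i, j⟩ hp
    simp only [Finset.mem_product, Finset.mem_range] at hp
    by_cases hij : i < j
    · simp only [hij, if_true, Finset.mem_product, Finset.mem_range]; omega
    · simp only [hij, if_false, Finset.mem_product, Finset.mem_range]; omega
  · rintro ⟨i, j⟩ hp
    by_cases hij : i < j
    · have : ¬ (j - 1 < i) := by omega
      simp only [hij, if_true, this, if_false, Prod.mk.injEq, true_and]; omega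
    · have : j < i + 1 := by omega
      simp [hij, this]

theorem sum_mixed {A : Type*} [AddCommGroup A] (n : ℕ) (P Q : ℕ → ℕ → A)
    (h1 : ∀ k j, k ≤ j → j < n → P (j + 1) k = Q k j)
    (h2 : ∀ k j, j < k → k ≤ n → P j (k + 1) = Q k j)
    (h3 : ∀ j, j < n → P (j + 1) (j + 1) = P j (j + 1))
    (h4 : P 0 0 = P n (n + 1)) :
    ∑ p ∈ Finset.range (n + 1) ×ˢ Finset.range (n + 2), (-1 : ℤ) ^ (p.1 + p.2) • P p.1 p.2 +
    ∑ p ∈ Finset.range (n + 1) ×ˢ Finset.range n, (-1 : ℤ) ^ (p.1 + p.2) • Q p.1 p.2 = 0 := by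
  have hdiag : ∑ p ∈ (Finset.range (n + 1) ×ˢ Finset.range (n + 2)).filter
      (fun p => p.2 = p.1 ∨ p.2 = p.1 + 1), (-1 : ℤ) ^ (p.1 + p.2) • P p.1 p.2 = 0 := by
    have e : (Finset.range (n + 1) ×ˢ Finset.range (n + 2)).filter
      (fun p => p.2 = p.1 ∨ p.2 = p.1 + 1) =
      (Finset.range (n + 1)).image (fun j => (j, j)) ∪
      (Finset.range (n + 1)).image (fun j => (j, j + 1)) := by
      ext ⟨a, b⟩
      simp only [Finset.mem_filter, Finset.mem_product, Finset.mem_range, Finset.mem_union,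
        Finset.mem_image, Prod.mk.injEq]
      constructor
      · rintro ⟨⟨ha, hb⟩, h | h⟩
        · exact Or.inl ⟨a, ha, rfl, h.symm⟩
        · exact Or.inr ⟨a, ha, rfl, h.symm⟩
      · rintro (⟨j, h, rfl, rfl⟩ | ⟨j, h, rfl, rfl⟩) <;> omega
    rw [e, Finset.sum_union, Finset.sum_image (by intro a _ b _; simp),
      Finset.sum_image (by intro a _ b _; simp), Finset.sum_range_succ', Finset.sum_range_succ, h4]
    · have e1 : ∑ k ∈ Finset.range n, (-1 : ℤ) ^ (k + 1 + (k + 1)) • P (k + 1) (k + 1) =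
          - ∑ k ∈ Finset.range n, (-1 : ℤ) ^ (k + (k + 1)) • P k (k + 1) := by
        rw [← Finset.sum_neg_distrib]
        refine Finset.sum_congr rfl fun k hk => ?_
        rw [h3 k (Finset.mem_range.1 hk), ← neg_smul]
        congr 1; ring
      rw [e1]
      have e2 : (-1 : ℤ) ^ (n + (n + 1)) = -1 := Odd.neg_one_pow ⟨n, by ring⟩
      rw [e2]; simp; abel
    · rw [Finset.disjoint_left]
      rintro ⟨a, b⟩ ha hb
      simp only [Finset.mem_image, Prod.mk.injEq] at ha hb
      obtain ⟨_, _, rfl, rfl⟩ := ha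
      obtain ⟨_, _, h, h'⟩ := hb
      omega
  rw [← Finset.sum_filter_add_sum_filter_not _ (fun p : ℕ × ℕ => p.2 = p.1 ∨ p.2 = p.1 + 1), hdiag,
    zero_add, add_eq_zero_iff_eq_neg, ← Finset.sum_neg_distrib]
  refine Finset.sum_nbij' (fun p => if p.2 < p.1 then (p.2, p.1 - 1) else (p.2 - 1, p.1))
    (fun q => if q.1 ≤ q.2 then (q.2 + 1, q.1) else (q.2, q.1 + 1)) ?_ ?_ ?_ ?_ ?_
  · rintro ⟨j, k⟩ hp
    simp only [Finset.mem_filter, Finset.mem_product, Finset.mem_range] at hp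
    split_ifs <;> simp only [Finset.mem_product, Finset.mem_range] <;> simp only at * <;> omega
  · rintro ⟨k, j⟩ hp
    simp only [Finset.mem_product, Finset.mem_range] at hp
    split_ifs <;> simp only [Finset.mem_filter, Finset.mem_product, Finset.mem_range] <;>
      simp only at * <;> omega
  · rintro ⟨j, k⟩ hp
    simp only [Finset.mem_filter, Finset.mem_product, Finset.mem_range] at hp
    by_cases hjk : k < j
    · have : k ≤ j - 1 := by omega
      simp only [hjk, this, if_true, Prod.mk.injEq, and_true]; omega
    · have : ¬ (k - 1 ≤ j) := by omega
      simp only [hjk, this, if_false, Prod.mk.injEq, true_and]; omega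
  · rintro ⟨k, j⟩ hp
    by_cases hjk : k ≤ j
    · have : k < j + 1 := by omega
      simp [hjk, this]
    · have : ¬ (k + 1 < j) := by omega
      simp [hjk, this]
  · rintro ⟨j, k⟩ hp
    simp only [Finset.mem_filter, Finset.mem_product, Finset.mem_range] at hp
    by_cases hjk : k < j
    · obtain ⟨j, rfl⟩ : ∃ j', j = j' + 1 := ⟨j - 1, by omega⟩
      simp only [hjk, if_true, Nat.add_sub_cancel]
      rw [h1 k j (by omega) (by omega), ← neg_smul]
      congr 1; ring
    · obtain ⟨k, rfl⟩ : ∃ j', k = j' + 1 := ⟨k - 1, by omega⟩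
      simp only [hjk, if_false, Nat.add_sub_cancel]
      rw [h2 k j (by omega) (by omega), ← neg_smul]
      congr 1; ring

theorem dM_single (x : MComp) (c : ℤ) : dM (Finsupp.single x c) = c • dMval x := by
  simp [dM]

theorem dI_single (x : MComp) (c : ℤ) : dI (Finsupp.single x c) = c • dIval x := by
  simp [dI]

theorem dMval_of_length (x : MComp) (n : ℕ) (h : x.1.length = n + 1) :
    dMval x = -∑ k ∈ Finset.range (n + 2), (-1 : ℤ) ^ k • Finsupp.single (mergeM x k) (1 : ℤ) := by
  simp [dMval, h]

theorem dIval_of_length (x : MComp) (n : ℕ) (h : x.1.length = n) :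
    dIval x = ∑ k ∈ Finset.range (n + 1), (-1 : ℤ) ^ k • Finsupp.single (insertM x k) (1 : ℤ) := by
  simp [dIval, h]

theorem insertM_length (x : MComp) (k : ℕ) : (insertM x k).1.length = x.1.length + 1 :=
  insertC_length _ _

theorem dM_dMval (x : MComp) : dM (dMval x) = 0 := by
  rcases hl : x.1.length with _ | n
  · simp [dMval, hl]
  rw [dMval_of_length x n hl, map_neg, map_sum]
  rcases n with _ | n
  · rw [neg_eq_zero]
    refine Finset.sum_eq_zero fun k hk => ?_
    have := mergeM_length x k (by have := Finset.mem_range.1 hk; omega) (by omega)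
    have h0 : (mergeM x k).1.length = 0 := by omega
    rw [map_smul, dM_single, dMval, if_pos h0]; simp
  · have := sum_simplicial (n + 2)
      (fun i j => Finsupp.single (mergeM (mergeM x j) i) (1 : ℤ)) (fun i j hij hj => by
        rw [MM_comm x i j hij (by omega) (by omega)])
    rw [Finset.sum_product_right] at this
    rw [← this, ← Finset.sum_neg_distrib]
    refine Finset.sum_congr rfl fun k hk => ?_
    have := mergeM_length x k (by have := Finset.mem_range.1 hk; omega) (by omega)
    rw [map_smul, dM_single, one_smul, dMval_of_length _ n (by omega), smul_neg, neg_neg,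
      Finset.smul_sum]
    refine Finset.sum_congr rfl fun i _ => ?_
    rw [smul_smul, pow_add, mul_comm]

theorem dI_dIval (x : MComp) : dI (dIval x) = 0 := by
  rw [dIval_of_length x _ rfl, map_sum]
  have := sum_simplicial (x.1.length + 1)
      (fun i j => Finsupp.single (insertM (insertM x i) j) (1 : ℤ)) (fun i j hij hj => by
        simp only [insertM]
        rw [insertC_comm x.1 i j hij (by omega)])
  rw [Finset.sum_product] at this
  rw [← this]
  refine Finset.sum_congr rfl fun k hk => ?_
  rw [map_smul, dI_single, one_smul, dIval_of_length _ _ (insertM_length x k), Finset.smul_sum]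
  refine Finset.sum_congr rfl fun i _ => ?_
  rw [smul_smul, pow_add]

theorem dM_dI_val (x : MComp) : dM (dIval x) + dI (dMval x) = 0 := by
  have := sum_mixed x.1.length
      (fun j k => Finsupp.single (mergeM (insertM x j) k) (1 : ℤ))
      (fun k j => Finsupp.single (insertM (mergeM x k) j) (1 : ℤ))
      (fun k j h h' => by rw [MI_le x k j h h'])
      (fun k j h h' => by rw [MI_gt x k j h h'])
      (fun j h => by rw [MI_eq x j h])
      (by rw [MI_ends x])
  rw [Finset.sum_product, Finset.sum_product] at this
  rw [← neg_eq_zero, ← this, neg_add]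
  congr 1
  · rw [dIval_of_length x _ rfl, map_sum, ← Finset.sum_neg_distrib]
    refine Finset.sum_congr rfl fun k hk => ?_
    rw [map_smul, dM_single, one_smul, dMval_of_length _ _ (insertM_length x k), smul_neg, neg_neg,
      Finset.smul_sum]
    refine Finset.sum_congr rfl fun i _ => ?_
    rw [smul_smul, pow_add]
  · rcases hl : x.1.length with _ | n
    · simp [dMval, hl]
    rw [dMval_of_length x n hl, map_neg, neg_neg, map_sum]
    refine Finset.sum_congr rfl fun k hk => ?_
    have := mergeM_length x k (by have := Finset.mem_range.1 hk; omega) (by omega)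
    rw [map_smul, dI_single, one_smul, dIval_of_length _ n (by omega), Finset.smul_sum]
    refine Finset.sum_congr rfl fun i _ => ?_
    rw [smul_smul, pow_add]

/-- On the free `ℤ`-module `ℤ[Ω^∞]` with basis the set of all marked
compositions, the merge and insert operators are anticommuting differentials. -/
theorem merge_insert_anticommuting_differentials :
    dM ∘ₗ dM = 0 ∧ dI ∘ₗ dI = 0 ∧ dM ∘ₗ dI + dI ∘ₗ dM = 0 := by
  refine ⟨?_, ?_, ?_⟩ <;> refine Finsupp.lhom_ext fun x c => ?_
  · simp [dM_single, dM_dMval]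
  · simp [dI_single, dI_dIval]
  · simp only [LinearMap.add_apply, LinearMap.comp_apply, dM_single, dI_single, map_smul,
      ← smul_add, dM_dI_val, smul_zero, LinearMap.zero_apply]
end

section
/- For every integer d ≥ 1 and every closed subset Θ ⊆ Ω_{⟨d]}, the univariate truncated differential ∂ maps the free ℤ-module ℤ[Θ] into itself, satisfies ∂∘∂ = 0, and sends each basis element ω to a ℤ-linear combination of compositions of reduced norm |ω|' + 1; thus (ℤ[Θ], ∂) is a differential complex graded by reduced norm (this is the complex which, by the paper, computes the reduced homology of the one-point compactification of P_d^Θ). -/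
/-- The value of the univariate merge differential `∂_M` on a basis element:
`-Σ_{k=1}^{ℓ-1} (-1)^k M_k(ω)`. -/
noncomputable def dMCval (ω : Comp) : Comp →₀ ℤ :=
  -∑ k ∈ Finset.Icc 1 (ω.length - 1), Finsupp.single (mergeAux ω (k - 1)) ((-1 : ℤ) ^ k)

/-- The value of the univariate insert differential `∂_I` on a basis element:
`Σ_{k=0}^{ℓ} (-1)^k I_k(ω)`. -/
noncomputable def dICval (ω : Comp) : Comp →₀ ℤ :=
  ∑ k ∈ Finset.range (ω.length + 1), Finsupp.single (insertC ω k) ((-1 : ℤ) ^ k)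

/-- The univariate truncated differential `∂` at level `m`. -/
noncomputable def dP (m : ℕ) : (Comp →₀ ℤ) →ₗ[ℤ] (Comp →₀ ℤ) :=
  Finsupp.lsum ℤ fun ω => LinearMap.toSpanSingleton ℤ (Comp →₀ ℤ)
    (if normC ω = m then dMCval ω else dMCval ω + dICval ω)

/-! ### Helper linear maps -/

/-- Linear map sending the basis element `ω` to `f ω`. -/
noncomputable def linC (f : Comp → (Comp →₀ ℤ)) : (Comp →₀ ℤ) →ₗ[ℤ] (Comp →₀ ℤ) :=
  Finsupp.linearCombination ℤ f

lemma linC_single (f : Comp → (Comp →₀ ℤ)) (ω : Comp) (c : ℤ) :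
    linC f (Finsupp.single ω c) = c • f ω := by
  simp [linC]

lemma lin_ext {F G : (Comp →₀ ℤ) →ₗ[ℤ] (Comp →₀ ℤ)}
    (h : ∀ ω, F (Finsupp.single ω 1) = G (Finsupp.single ω 1)) : F = G := by
  apply Finsupp.lhom_ext'
  intro ω
  ext1
  simpa using h ω

/-- Prepend the part `a`. -/
noncomputable def consL (a : PNat) : (Comp →₀ ℤ) →ₗ[ℤ] (Comp →₀ ℤ) :=
  linC fun ω => Finsupp.single (a :: ω) 1

/-- Add `a` to the first part (zero on the empty composition). -/
noncomputable def addL (a : PNat) : (Comp →₀ ℤ) →ₗ[ℤ] (Comp →₀ ℤ) :=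
  linC fun ω => match ω with
    | [] => 0
    | b :: t => Finsupp.single ((a + b) :: t) 1

lemma consL_single (a : PNat) (ω : Comp) (c : ℤ) :
    consL a (Finsupp.single ω c) = Finsupp.single (a :: ω) c := by
  simp [consL, linC_single]

lemma addL_nil (a : PNat) (c : ℤ) : addL a (Finsupp.single [] c) = 0 := by
  simp [addL, linC_single]

lemma addL_cons_single (a b : PNat) (t : Comp) (c : ℤ) :
    addL a (Finsupp.single (b :: t) c) = Finsupp.single ((a + b) :: t) c := by
  simp [addL, linC_single]

lemma addL_consL (a b : PNat) (v : Comp →₀ ℤ) : addL a (consL b v) = consL (a + b) v := by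
  have : addL a ∘ₗ consL b = consL (a + b) :=
    lin_ext fun ω => by simp [consL_single, addL_cons_single]
  exact LinearMap.congr_fun this v

lemma addL_addL (a b : PNat) (v : Comp →₀ ℤ) : addL a (addL b v) = addL (a + b) v := by
  have : addL a ∘ₗ addL b = addL (a + b) :=
    lin_ext fun ω => by
      cases ω <;> simp [addL_nil, addL_cons_single, add_assoc]
  exact LinearMap.congr_fun this v

noncomputable def dIL : (Comp →₀ ℤ) →ₗ[ℤ] (Comp →₀ ℤ) := linC dICval

noncomputable def dML : (Comp →₀ ℤ) →ₗ[ℤ] (Comp →₀ ℤ) := linC dMCval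

lemma dICval_nil : dICval [] = Finsupp.single [2] 1 := by
  simp [dICval, insertC]

lemma dICval_cons (a : PNat) (t : Comp) :
    dICval (a :: t) = Finsupp.single (2 :: a :: t) 1 - consL a (dICval t) := by
  unfold dICval
  rw [List.length_cons, Finset.sum_range_succ', map_sum, add_comm, sub_eq_add_neg,
    ← Finset.sum_neg_distrib]
  congr 1
  refine Finset.sum_congr rfl fun k _ => ?_
  rw [consL_single, ← Finsupp.single_neg, pow_succ]
  simp [insertC]

lemma dMCval_eq (ω : Comp) :
    dMCval ω = ∑ k ∈ Finset.range (ω.length - 1),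
      Finsupp.single (mergeAux ω k) ((-1 : ℤ) ^ k) := by
  unfold dMCval
  rw [← Finset.sum_neg_distrib, Finset.range_eq_Ico]
  have h := Finset.sum_Ico_add' (fun k => -(Finsupp.single (mergeAux ω (k - 1)) ((-1 : ℤ) ^ k)))
    0 (ω.length - 1) 1
  have h2 : Finset.Icc 1 (ω.length - 1) = Finset.Ico (0 + 1) (ω.length - 1 + 1) := by
    ext x; simp
  rw [h2, ← h]
  refine Finset.sum_congr rfl fun k _ => ?_
  rw [← Finsupp.single_neg, pow_succ]
  simp

lemma dMCval_nil : dMCval [] = 0 := by simp [dMCval_eq]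

lemma dMCval_cons (a : PNat) (t : Comp) :
    dMCval (a :: t) = addL a (Finsupp.single t 1) - consL a (dMCval t) := by
  cases t with
  | nil => simp [dMCval_eq, addL_nil]
  | cons b t =>
    rw [dMCval_eq, dMCval_eq, addL_cons_single]
    simp only [List.length_cons, Nat.add_sub_cancel]
    rw [Finset.sum_range_succ', map_sum, add_comm, sub_eq_add_neg,
      ← Finset.sum_neg_distrib]
    congr 1
    refine Finset.sum_congr rfl fun k _ => ?_
    rw [consL_single, ← Finsupp.single_neg, pow_succ]
    simp [mergeAux]

lemma dIL_single (ω : Comp) : dIL (Finsupp.single ω 1) = dICval ω := by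
  simp [dIL, linC_single]

lemma dML_single (ω : Comp) : dML (Finsupp.single ω 1) = dMCval ω := by
  simp [dML, linC_single]

lemma dIL_consL (a : PNat) (v : Comp →₀ ℤ) :
    dIL (consL a v) = consL 2 (consL a v) - consL a (dIL v) := by
  have : dIL ∘ₗ consL a = consL 2 ∘ₗ consL a - consL a ∘ₗ dIL :=
    lin_ext fun ω => by
      simp [consL_single, dIL_single, dICval_cons]
  exact LinearMap.congr_fun this v

lemma dML_consL (a : PNat) (v : Comp →₀ ℤ) :
    dML (consL a v) = addL a v - consL a (dML v) := by
  have : dML ∘ₗ consL a = addL a - consL a ∘ₗ dML :=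
    lin_ext fun ω => by
      simp [consL_single, dML_single, dMCval_cons]
  exact LinearMap.congr_fun this v

lemma dML_addL (a : PNat) (v : Comp →₀ ℤ) : dML (addL a v) = addL a (dML v) := by
  have : dML ∘ₗ addL a = addL a ∘ₗ dML :=
    lin_ext fun ω => by
      cases ω with
      | nil => simp [addL_nil, dML_single, dMCval_nil]
      | cons b t =>
        simp only [LinearMap.comp_apply]
        rw [← consL_single b t 1, addL_consL, dML_consL, dML_consL, map_sub, addL_addL, addL_consL]
  exact LinearMap.congr_fun this v

lemma dIL_addL (a : PNat) (v : Comp →₀ ℤ) :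
    dIL (addL a v) = addL a (dIL v) + consL 2 (addL a v) - addL 2 (consL a v) := by
  have : dIL ∘ₗ addL a = addL a ∘ₗ dIL + consL 2 ∘ₗ addL a - addL 2 ∘ₗ consL a :=
    lin_ext fun ω => by
      cases ω with
      | nil =>
        simp [addL_nil, dIL_single, dICval_nil, consL_single, addL_cons_single, add_comm]
      | cons b t =>
        simp only [LinearMap.comp_apply, LinearMap.add_apply, LinearMap.sub_apply]
        rw [← consL_single b t 1]
        simp only [addL_consL, dIL_consL, map_sub]
        rw [add_comm 2 a]
        abel
  exact LinearMap.congr_fun this v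

lemma dIL_dIL (v : Comp →₀ ℤ) : dIL (dIL v) = 0 := by
  have : dIL ∘ₗ dIL = 0 := lin_ext fun ω => by
    simp only [LinearMap.comp_apply, LinearMap.zero_apply]
    induction ω with
    | nil =>
      rw [dIL_single, dICval_nil, dIL_single, dICval_cons, dICval_nil, consL_single, sub_self]
    | cons a t ih =>
      rw [← consL_single a t 1]
      simp only [dIL_consL, map_sub, ih, map_zero]
      abel
  exact LinearMap.congr_fun this v

lemma dML_dML (v : Comp →₀ ℤ) : dML (dML v) = 0 := by
  have : dML ∘ₗ dML = 0 := lin_ext fun ω => by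
    simp only [LinearMap.comp_apply, LinearMap.zero_apply]
    induction ω with
    | nil => rw [dML_single, dMCval_nil, map_zero]
    | cons a t ih =>
      rw [← consL_single a t 1]
      simp only [dML_consL, dML_addL, map_sub, ih, map_zero]
      abel
  exact LinearMap.congr_fun this v

lemma dML_dIL (v : Comp →₀ ℤ) : dML (dIL v) + dIL (dML v) = 0 := by
  have : dML ∘ₗ dIL + dIL ∘ₗ dML = 0 := lin_ext fun ω => by
    simp only [LinearMap.comp_apply, LinearMap.zero_apply, LinearMap.add_apply]
    induction ω with
    | nil =>
      rw [dML_single, dMCval_nil, map_zero, dIL_single, dICval_nil, dML_single, dMCval_cons,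
        dMCval_nil, addL_nil, map_zero, sub_zero, add_zero]
    | cons a t ih =>
      rw [← consL_single a t 1]
      simp only [dML_consL, dIL_consL, dIL_addL, map_sub]
      rw [← map_zero (consL a), ← ih, map_add]
      abel
  exact LinearMap.congr_fun this v

/-! ### Norms -/

lemma normC_cons (a : PNat) (t : Comp) : normC (a :: t) = a + normC t := by simp [normC]

lemma length_le_normC (ω : Comp) : ω.length ≤ normC ω := by
  induction ω with
  | nil => simp [normC]
  | cons a t ih =>
    have := a.pos
    rw [normC_cons, List.length_cons]; omega

lemma normC_insertC (ω : Comp) (k : ℕ) : normC (insertC ω k) = normC ω + 2 := by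
  have two : ((2 : PNat) : ℕ) = 2 := rfl
  induction ω generalizing k with
  | nil => simp [insertC, normC_cons, two, add_comm]
  | cons a t ih =>
    cases k with
    | zero => simp only [insertC, List.take_zero, List.drop_zero, List.nil_append, normC_cons]; omega
    | succ k =>
      have h := ih k
      have e : insertC (a :: t) (k + 1) = a :: insertC t k := by simp [insertC]
      rw [e, normC_cons, normC_cons, h]; omega

lemma length_insertC (ω : Comp) (k : ℕ) : (insertC ω k).length = ω.length + 1 := by
  simp [insertC]; omega

lemma mergeAux_spec (ω : Comp) : ∀ k, k + 2 ≤ ω.length →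
    normC (mergeAux ω k) = normC ω ∧ (mergeAux ω k).length + 1 = ω.length := by
  induction ω with
  | nil => intro k h; simp at h
  | cons a t ih =>
    intro k h
    cases k with
    | zero =>
      cases t with
      | nil => simp at h
      | cons b t => simp [mergeAux, normC_cons, add_assoc]
    | succ k =>
      have := ih k (by simp at h; omega)
      cases t with
      | nil => simp at h
      | cons b t => simpa [mergeAux, normC_cons] using this

lemma dMCval_mem (ω : Comp) (S : Set Comp)
    (h : ∀ k, k + 2 ≤ ω.length → mergeAux ω k ∈ S) :
    dMCval ω ∈ Finsupp.supported ℤ ℤ S := by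
  rw [dMCval_eq]
  refine Submodule.sum_mem _ fun k hk => Finsupp.single_mem_supported _ _ (h k ?_)
  rw [Finset.mem_range] at hk; omega

lemma dICval_mem (ω : Comp) (S : Set Comp)
    (h : ∀ k, k ≤ ω.length → insertC ω k ∈ S) :
    dICval ω ∈ Finsupp.supported ℤ ℤ S := by
  refine Submodule.sum_mem _ fun k hk => Finsupp.single_mem_supported _ _ (h k ?_)
  rw [Finset.mem_range] at hk; omega

lemma dP_single (m : ℕ) (ω : Comp) : dP m (Finsupp.single ω 1) =
    if normC ω = m then dMCval ω else dMCval ω + dICval ω := by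
  simp [dP]

/-- Vectors supported at norm `m`. -/
lemma dP_of_eq (m : ℕ) (v : Comp →₀ ℤ) (hv : v ∈ Finsupp.supported ℤ ℤ {ω | normC ω = m}) :
    dP m v = dML v := by
  rw [Finsupp.supported_eq_span_single] at hv
  induction hv using Submodule.span_induction with
  | mem x hx =>
    obtain ⟨ω, hω, rfl⟩ := hx
    rw [dP_single, dML_single, if_pos (show normC ω = m from hω)]
  | zero => simp
  | add x y _ _ hx hy => rw [map_add, map_add, hx, hy]
  | smul c x _ hx => rw [map_smul, map_smul, hx]

lemma dP_of_ne (m n : ℕ) (hn : n ≠ m) (v : Comp →₀ ℤ)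
    (hv : v ∈ Finsupp.supported ℤ ℤ {ω | normC ω = n}) :
    dP m v = dML v + dIL v := by
  rw [Finsupp.supported_eq_span_single] at hv
  induction hv using Submodule.span_induction with
  | mem x hx =>
    obtain ⟨ω, hω, rfl⟩ := hx
    have hω' : normC ω = n := hω
    rw [dP_single, dML_single, dIL_single, if_neg (by omega)]
  | zero => simp
  | add x y _ _ hx hy => rw [map_add, map_add, map_add, hx, hy]; abel
  | smul c x _ hx => rw [map_smul, map_smul, map_smul, hx, smul_add]

lemma dP_dP (m : ℕ) (v : Comp →₀ ℤ) : dP m (dP m v) = 0 := by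
  have : dP m ∘ₗ dP m = 0 := lin_ext fun ω => by
    simp only [LinearMap.comp_apply, LinearMap.zero_apply]
    have hM : dMCval ω ∈ Finsupp.supported ℤ ℤ {ω' | normC ω' = normC ω} :=
      dMCval_mem ω _ fun k hk => (mergeAux_spec ω k hk).1
    have hI : dICval ω ∈ Finsupp.supported ℤ ℤ {ω' | normC ω' = normC ω + 2} :=
      dICval_mem ω _ fun k _ => normC_insertC ω k
    have e1 := dML_dML (Finsupp.single ω 1)
    have e2 := dIL_dIL (Finsupp.single ω 1)
    have e3 := dML_dIL (Finsupp.single ω 1)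
    rw [dML_single] at e1
    rw [dIL_single] at e2
    rw [dML_single, dIL_single] at e3
    rw [dP_single]
    by_cases h : normC ω = m
    · rw [if_pos h, dP_of_eq m _ (h ▸ hM), e1]
    · rw [if_neg h, map_add, dP_of_ne m _ h _ hM, e1, zero_add]
      by_cases h2 : normC ω + 2 = m
      · rw [dP_of_eq m _ (h2 ▸ hI), add_comm, e3]
      · rw [dP_of_ne m _ h2 _ hI, e2, add_zero, add_comm, e3]
  exact LinearMap.congr_fun this v

/-- For every `d ≥ 1` and every closed `Θ ⊆ Ω_{⟨d]}`, the univariate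
truncated differential `∂` maps `ℤ[Θ]` into itself, squares to zero there, and raises the
reduced norm by exactly `1` on basis elements. -/
theorem univariate_truncated_differential_complex (d : ℕ) (hd : 1 ≤ d) (Θ : Set Comp)
    (hsub : Θ ⊆ {ω : Comp | normC ω ≤ d ∧ normC ω % 2 = d % 2})
    (hclosed : ∀ ω ∈ Θ, ∀ ω' : Comp, cprec ω' ω → normC ω' ≤ d → ω' ∈ Θ) :
    (∀ v ∈ Finsupp.supported ℤ ℤ Θ, dP d v ∈ Finsupp.supported ℤ ℤ Θ) ∧
    (∀ v ∈ Finsupp.supported ℤ ℤ Θ, dP d (dP d v) = 0) ∧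
    (∀ ω ∈ Θ, dP d (Finsupp.single ω 1) ∈
      Finsupp.supported ℤ ℤ {ω' : Comp | rnormC ω' = rnormC ω + 1}) := by
  refine ⟨fun v hv => ?_, fun v _ => dP_dP d v, fun ω _ => ?_⟩
  · rw [Finsupp.supported_eq_span_single] at hv
    induction hv using Submodule.span_induction with
    | mem x hx =>
      obtain ⟨ω, hω, rfl⟩ := hx
      obtain ⟨h1, h2⟩ := hsub hω
      have hM : dMCval ω ∈ Finsupp.supported ℤ ℤ Θ := dMCval_mem ω _ fun k hk =>
        hclosed ω hω _ (Relation.ReflTransGen.single (Or.inl ⟨k, hk, rfl⟩))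
          (by rw [(mergeAux_spec ω k hk).1]; exact h1)
      rw [dP_single]
      split_ifs with h
      · exact hM
      · refine Submodule.add_mem _ hM (dICval_mem ω _ fun k hk => ?_)
        exact hclosed ω hω _ (Relation.ReflTransGen.single (Or.inr ⟨k, hk, rfl⟩))
          (by rw [normC_insertC]; omega)
    | zero => rw [map_zero]; exact Submodule.zero_mem _
    | add x y _ _ hx hy => rw [map_add]; exact Submodule.add_mem _ hx hy
    | smul c x _ hx => rw [map_smul]; exact Submodule.smul_mem _ c hx
  · have hl := length_le_normC ω
    have hM : dMCval ω ∈ Finsupp.supported ℤ ℤ {ω' : Comp | rnormC ω' = rnormC ω + 1} :=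
      dMCval_mem ω _ fun k hk => by
        obtain ⟨a, b⟩ := mergeAux_spec ω k hk
        simp only [Set.mem_ofPred_eq, rnormC]
        omega
    have hI : dICval ω ∈ Finsupp.supported ℤ ℤ {ω' : Comp | rnormC ω' = rnormC ω + 1} :=
      dICval_mem ω _ fun k _ => by
        simp only [Set.mem_ofPred_eq, rnormC, normC_insertC, length_insertC]
        omega
    rw [dP_single]
    split_ifs with h
    · exact hM
    · exact Submodule.add_mem _ hM hI
end

section
/- Let d ≥ 1 and let ω be a composition with |ω| ≤ d and |ω| ≡ d (mod 2). Then the closure of S_d(ω) in ℝ^d equals the union of the sets S_d(ω') taken over all compositions ω' with ω' ⪯ ω (where S_d(ω') is empty whenever |ω'| > d). -/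
/-- `P` has real root multiplicity pattern `ω`: there are reals `x₁ < ⋯ < x_ℓ` such that
`x_i` is a root of `P` of multiplicity exactly `ω_i`, and `P` has no other real roots. -/
def hasPattern (P : Polynomial ℝ) (ω : Comp) : Prop :=
  P ≠ 0 ∧ ∃ x : Fin ω.length → ℝ, StrictMono x ∧
    (∀ i : Fin ω.length, Polynomial.rootMultiplicity (x i) P = (ω.get i : ℕ)) ∧
    ∀ y : ℝ, P.IsRoot y → ∃ i : Fin ω.length, y = x i

/-- The monic polynomial `X^d + a_{d-1}X^{d-1} + ⋯ + a₀` attached to `a ∈ ℝ^d`. -/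
noncomputable def polyOf (d : ℕ) (a : Fin d → ℝ) : Polynomial ℝ :=
  Polynomial.X ^ d + ∑ i : Fin d, Polynomial.C (a i) * Polynomial.X ^ (i : ℕ)

/-- `S_d(ω)`: the set of `a ∈ ℝ^d` whose associated monic polynomial has real root
multiplicity pattern `ω`. -/
def Sset (d : ℕ) (ω : Comp) : Set (Fin d → ℝ) := {a | hasPattern (polyOf d a) ω}

open Polynomial Filter Topology

namespace CS

/-- The product of `(X - r)^m` over a list of pairs `(r, m)`. -/
noncomputable def W (l : List (ℝ × PNat)) : ℝ[X] :=
  (l.map fun p => (X - C p.1) ^ (p.2 : ℕ)).prod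

/-- Coefficientwise convergence. -/
def PT {β : Type} (F : β → ℝ[X]) (f : Filter β) (P : ℝ[X]) : Prop :=
  ∀ k, Tendsto (fun b => (F b).coeff k) f (𝓝 (P.coeff k))

lemma PT.const {β : Type} {f : Filter β} (P : ℝ[X]) : PT (fun _ : β => P) f P :=
  fun _ => tendsto_const_nhds

lemma PT.mul {β : Type} {f : Filter β} {F G : β → ℝ[X]} {P Q : ℝ[X]} (h : PT F f P)
    (h' : PT G f Q) : PT (fun b => F b * G b) f (P * Q) := by
  intro k
  simp only [coeff_mul]
  exact tendsto_finsetSum _ fun i _ => (h i.1).mul (h' i.2)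

lemma PT.pow {β : Type} {f : Filter β} {F : β → ℝ[X]} {P : ℝ[X]} (h : PT F f P) (n : ℕ) :
    PT (fun b => F b ^ n) f (P ^ n) := by
  induction n with
  | zero => simpa using PT.const (f := f) (1 : ℝ[X])
  | succ n ih => simpa only [pow_succ] using ih.mul h

lemma PT.add {β : Type} {f : Filter β} {F G : β → ℝ[X]} {P Q : ℝ[X]} (h : PT F f P)
    (h' : PT G f Q) : PT (fun b => F b + G b) f (P + Q) := by
  intro k
  simp only [coeff_add]
  exact (h k).add (h' k)

lemma PT.C {β : Type} {f : Filter β} {x : β → ℝ} {y : ℝ} (h : Tendsto x f (𝓝 y)) :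
    PT (fun b => C (x b)) f (C y) := by
  intro k
  simp only [coeff_C]
  split_ifs
  · exact h
  · exact tendsto_const_nhds

lemma PT.X_sub_C {β : Type} {f : Filter β} {x : β → ℝ} {y : ℝ} (h : Tendsto x f (𝓝 y)) :
    PT (fun b => X - Polynomial.C (x b)) f (X - Polynomial.C y) := by
  simp only [sub_eq_add_neg, ← C_neg]
  exact (PT.const X).add (PT.C h.neg)

lemma PT.eval {β : Type} {f : Filter β} {F : β → ℝ[X]} {P : ℝ[X]} (h : PT F f P) {d : ℕ}
    (hd : ∀ b, (F b).natDegree ≤ d) (hP : P.natDegree ≤ d) {x : β → ℝ} {y : ℝ}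
    (hx : Tendsto x f (𝓝 y)) : Tendsto (fun b => (F b).eval (x b)) f (𝓝 (P.eval y)) := by
  rw [eval_eq_sum_range' (Nat.lt_succ_of_le hP)]
  have : (fun b => (F b).eval (x b)) =
      fun b => ∑ i ∈ Finset.range (d + 1), (F b).coeff i * (x b) ^ i := by
    funext b
    rw [eval_eq_sum_range' (Nat.lt_succ_of_le (hd b))]
  rw [this]
  exact tendsto_finsetSum _ fun i _ => (h i).mul (hx.pow i)

lemma PT.natDegree_le {β : Type} {f : Filter β} [f.NeBot] {F : β → ℝ[X]} {P : ℝ[X]}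
    (h : PT F f P) {d : ℕ} (hd : ∀ b, (F b).natDegree ≤ d) : P.natDegree ≤ d := by
  rw [natDegree_le_iff_coeff_eq_zero]
  intro k hk
  refine tendsto_nhds_unique (h k) ?_
  have : (fun b => (F b).coeff k) = fun _ => 0 := by
    funext b
    exact coeff_eq_zero_of_natDegree_lt ((hd b).trans_lt hk)
  rw [this]
  exact tendsto_const_nhds

lemma coeff_div (p : ℝ[X]) (r : ℝ) (d : ℕ) (hp : p.natDegree ≤ d) (n : ℕ) :
    (p /ₘ (X - C r)).coeff n =
      ∑ i ∈ Finset.Icc (n + 1) d, r ^ (i - (n + 1)) * p.coeff i := by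
  rw [coeff_divByMonic_X_sub_C]
  refine Finset.sum_subset (Finset.Icc_subset_Icc_right hp) ?_
  intro i hi hi'
  rw [coeff_eq_zero_of_natDegree_lt, mul_zero]
  simp only [Finset.mem_Icc] at hi hi'
  omega

lemma PT.div1 {β : Type} {f : Filter β} [f.NeBot] {F : β → ℝ[X]} {P : ℝ[X]} {x : β → ℝ} {y : ℝ}
    {d : ℕ} (h : PT (fun b => (X - Polynomial.C (x b)) * F b) f P)
    (hd : ∀ b, ((X - Polynomial.C (x b)) * F b).natDegree ≤ d)
    (hx : Tendsto x f (𝓝 y)) :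
    ∃ Q, PT F f Q ∧ P = (X - Polynomial.C y) * Q := by
  have hP := h.natDegree_le hd
  refine ⟨P /ₘ (X - Polynomial.C y), ?_, ?_⟩
  · intro k
    rw [coeff_div P y d hP]
    have : (fun b => (F b).coeff k) = fun b => ∑ i ∈ Finset.Icc (k + 1) d,
        (x b) ^ (i - (k + 1)) * ((X - Polynomial.C (x b)) * F b).coeff i := by
      funext b
      rw [← coeff_div _ _ d (hd b), mul_divByMonic_cancel_left _ (monic_X_sub_C _)]
    rw [this]
    exact tendsto_finsetSum _ fun i _ => (hx.pow _).mul (h i)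
  · symm
    rw [mul_divByMonic_eq_iff_isRoot]
    have := h.eval hd hP hx
    refine tendsto_nhds_unique this ?_
    simp

lemma natDegree_aux (D G : ℝ[X]) (hD : D.Monic) {d : ℕ} (h : (D * G).natDegree ≤ d) :
    G.natDegree ≤ d := by
  rcases eq_or_ne G 0 with rfl | hG
  · simp
  · rw [hD.natDegree_mul' hG] at h
    omega

lemma PT.divpow {β : Type} {f : Filter β} [f.NeBot] {x : β → ℝ} {y : ℝ} {d : ℕ}
    (hx : Tendsto x f (𝓝 y)) (m : ℕ) : ∀ {F : β → ℝ[X]} {P : ℝ[X]}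
    (_ : PT (fun b => (X - Polynomial.C (x b)) ^ m * F b) f P)
    (_ : ∀ b, ((X - Polynomial.C (x b)) ^ m * F b).natDegree ≤ d),
    ∃ Q, PT F f Q ∧ P = (X - Polynomial.C y) ^ m * Q := by
  induction m with
  | zero =>
    intro F P h _
    exact ⟨P, by simpa using h, by simp⟩
  | succ m ih =>
    intro F P h hd
    simp only [pow_succ, mul_assoc] at h hd
    obtain ⟨Q, hQ, rfl⟩ := ih h hd
    obtain ⟨Q', hQ', rfl⟩ := hQ.div1
      (fun b => natDegree_aux _ _ ((monic_X_sub_C _).pow m) (hd b)) hx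
    exact ⟨Q', hQ', by ring⟩

lemma PT.divlist {β ι : Type} {f : Filter β} [f.NeBot] {x : β → ι → ℝ} {y : ι → ℝ} {d : ℕ}
    (hx : ∀ i, Tendsto (fun b => x b i) f (𝓝 (y i))) (m : ι → ℕ) (l : List ι) :
    ∀ {F : β → ℝ[X]} {P : ℝ[X]}
    (_ : PT (fun b => (l.map fun i => (X - Polynomial.C (x b i)) ^ m i).prod * F b) f P)
    (_ : ∀ b, ((l.map fun i => (X - Polynomial.C (x b i)) ^ m i).prod * F b).natDegree ≤ d),
    ∃ Q, PT F f Q ∧ P = (l.map fun i => (X - Polynomial.C (y i)) ^ m i).prod * Q := by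
  induction l with
  | nil =>
    intro F P h _
    exact ⟨P, by simpa using h, by simp⟩
  | cons i l ih =>
    intro F P h hd
    simp only [List.map_cons, List.prod_cons, mul_assoc] at h hd
    obtain ⟨Q, hQ, rfl⟩ := PT.divpow (hx i) (m i) h hd
    obtain ⟨Q', hQ', rfl⟩ := ih hQ
      (fun b => natDegree_aux _ _ ((monic_X_sub_C _).pow _) (hd b))
    exact ⟨Q', hQ', by simp [mul_assoc]⟩

/-! ### Factorized form of patterns -/

lemma W_cons (p : ℝ × PNat) (l : List (ℝ × PNat)) :
    W (p :: l) = (X - C p.1) ^ (p.2 : ℕ) * W l := by simp [W]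

lemma W_append (l l' : List (ℝ × PNat)) : W (l ++ l') = W l * W l' := by simp [W]

lemma W_monic (l : List (ℝ × PNat)) : (W l).Monic := by
  induction l with
  | nil => simp [W]
  | cons p l ih => rw [W_cons]; exact ((monic_X_sub_C _).pow _).mul ih

lemma W_root {l : List (ℝ × PNat)} {y : ℝ} (h : (W l).IsRoot y) : ∃ p ∈ l, y = p.1 := by
  induction l with
  | nil => simp [W] at h
  | cons p l ih =>
    rw [W_cons, root_mul] at h
    rcases h with h | h
    · refine ⟨p, by simp, ?_⟩
      have : y - p.1 = 0 := by
        simpa [IsRoot.def] using h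
      linarith
    · obtain ⟨q, hq, e⟩ := ih h
      exact ⟨q, by simp [hq], e⟩

lemma rm_zero {P : ℝ[X]} {y : ℝ} (h : ¬ P.IsRoot y) : P.rootMultiplicity y = 0 :=
  rootMultiplicity_eq_zero h

lemma W_mult {l : List (ℝ × PNat)} (hl : l.Pairwise fun p q => p.1 < q.1) {p : ℝ × PNat}
    (hp : p ∈ l) : (W l).rootMultiplicity p.1 = p.2 := by
  induction l with
  | nil => simp at hp
  | cons q l ih =>
    rw [List.pairwise_cons] at hl
    rw [W_cons, rootMultiplicity_mul (((monic_X_sub_C _).pow _).mul (W_monic l)).ne_zero]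
    rcases List.mem_cons.1 hp with rfl | hp
    · rw [rootMultiplicity_X_sub_C_pow, rm_zero, add_zero]
      intro h
      obtain ⟨r, hr, e⟩ := W_root h
      have := hl.1 r hr
      linarith
    · rw [ih hl.2 hp, rm_zero, zero_add]
      intro h
      have h1 := hl.1 p hp
      have : p.1 - q.1 = 0 := by
        simpa [IsRoot.def] using h
      linarith

lemma hasPattern_of {l : List (ℝ × PNat)} (hl : l.Pairwise fun p q => p.1 < q.1) {Q : ℝ[X]}
    (hQ : ∀ y, ¬ Q.IsRoot y) : hasPattern (W l * Q) (l.map Prod.snd) := by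
  have hQ0 : Q ≠ 0 := by
    rintro rfl
    exact hQ 0 (by simp)
  have h0 : W l * Q ≠ 0 := mul_ne_zero (W_monic l).ne_zero hQ0
  refine ⟨h0, fun i => (l.get (i.cast (by simp))).1, ?_, ?_, ?_⟩
  · intro i j hij
    exact List.pairwise_iff_get.1 hl _ _ (by simpa using hij)
  · intro i
    rw [rootMultiplicity_mul h0, rm_zero (hQ _), W_mult hl (List.get_mem _ _)]
    simp
  · intro y hy
    rw [root_mul] at hy
    obtain ⟨p, hp, rfl⟩ := W_root (hy.resolve_right (hQ y))
    obtain ⟨i, rfl⟩ := List.get_of_mem hp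
    exact ⟨i.cast (by simp), by simp⟩

lemma of_hasPattern {P : ℝ[X]} {ω : Comp} (h : hasPattern P ω) :
    ∃ x : Fin ω.length → ℝ, StrictMono x ∧ ∃ Q : ℝ[X], (∀ y, ¬ Q.IsRoot y) ∧
      P = W (List.ofFn fun i => (x i, ω.get i)) * Q := by
  obtain ⟨h0, x, hx, hm, hr⟩ := h
  have hl : (List.ofFn fun i => (x i, ω.get i)).Pairwise fun p q => p.1 < q.1 := by
    rw [List.pairwise_ofFn]
    intro i j hij
    exact hx hij
  have hd : W (List.ofFn fun i => (x i, ω.get i)) ∣ P := by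
    have : W (List.ofFn fun i => (x i, ω.get i)) = ∏ i, (X - C (x i)) ^ (ω.get i : ℕ) := by
      simp [W, List.map_ofFn, List.prod_ofFn]
    rw [this]
    refine Fintype.prod_dvd_of_coprime ?_ ?_
    · intro i j hij
      exact (pairwise_coprime_X_sub_C hx.injective hij).pow
    · intro i
      rw [← hm i]
      exact pow_rootMultiplicity_dvd P (x i)
  obtain ⟨Q, rfl⟩ := hd
  refine ⟨x, hx, Q, ?_, rfl⟩
  intro y hy
  obtain ⟨i, rfl⟩ := hr y (by rw [root_mul]; exact Or.inr hy)
  have h1 := hm i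
  rw [rootMultiplicity_mul h0,
    W_mult hl (p := (x i, ω.get i)) ((List.mem_ofFn' _ _).2 ⟨i, rfl⟩)] at h1
  have := (rootMultiplicity_pos (right_ne_zero_of_mul h0)).2 hy
  simp only at h1
  omega

lemma of_hasPattern' {P : ℝ[X]} {ω : Comp} (h : hasPattern P ω) :
    ∃ l : List (ℝ × PNat), l.map Prod.snd = ω ∧ (l.Pairwise fun p q => p.1 < q.1) ∧
     ∃ Q : ℝ[X], (∀ y, ¬ Q.IsRoot y) ∧ P = W l * Q := by
  obtain ⟨x, hx, Q, hQ, e⟩ := of_hasPattern h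
  refine ⟨_, ?_, ?_, Q, hQ, e⟩
  · rw [List.map_ofFn]
    exact List.ofFn_get ω
  · rw [List.pairwise_ofFn]
    intro i j hij
    exact hx hij

/-! ### `polyOf` -/

lemma polyOf_coeff (d : ℕ) (a : Fin d → ℝ) (i : Fin d) : (polyOf d a).coeff i = a i := by
  simp only [polyOf, coeff_add, coeff_X_pow, finsetSum_coeff, coeff_C_mul]
  rw [Finset.sum_eq_single i]
  · simp [i.2.ne]
  · intro j _ hj
    have : (i : ℕ) ≠ j := fun h => hj (Fin.ext h.symm)
    simp [this]
  · simp

lemma polyOf_deg (d : ℕ) (a : Fin d → ℝ) :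
    (∑ i : Fin d, C (a i) * X ^ (i : ℕ)).degree < (d : WithBot ℕ) := by
  refine (degree_sum_le _ _).trans_lt ?_
  rw [Finset.sup_lt_iff (by exact WithBot.bot_lt_coe d)]
  intro i _
  exact (degree_C_mul_X_pow_le _ _).trans_lt (by exact_mod_cast i.2)

lemma polyOf_monic (d : ℕ) (a : Fin d → ℝ) : (polyOf d a).Monic :=
  monic_X_pow_add (polyOf_deg d a)

lemma polyOf_natDegree (d : ℕ) (a : Fin d → ℝ) : (polyOf d a).natDegree = d := by
  rw [polyOf, natDegree_add_eq_left_of_degree_lt, natDegree_X_pow]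
  rw [degree_X_pow]
  exact polyOf_deg d a

lemma polyOf_eq {d : ℕ} {P : ℝ[X]} (hP : P.Monic) (hd : P.natDegree = d) :
    polyOf d (fun i => P.coeff i) = P := by
  conv_rhs => rw [hP.as_sum, hd, Finset.sum_range]
  rfl

lemma PT_polyOf (d : ℕ) {β : Type} {f : Filter β} {x : β → Fin d → ℝ} {a : Fin d → ℝ}
    (h : Tendsto x f (𝓝 a)) : PT (fun b => polyOf d (x b)) f (polyOf d a) := by
  intro k
  by_cases hk : k < d
  · have := (tendsto_pi_nhds.1 h) ⟨k, hk⟩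
    simpa only [← polyOf_coeff] using this
  · have (z : Fin d → ℝ) : (polyOf d z).coeff k = (X ^ d : ℝ[X]).coeff k := by
      rw [polyOf, coeff_add, add_eq_left]
      refine coeff_eq_zero_of_degree_lt ?_
      exact (polyOf_deg d z).trans_le (by exact_mod_cast not_lt.1 hk)
    simp only [this]
    exact tendsto_const_nhds

/-- The closure criterion used for both operations. -/
lemma mem_closure_of {d : ℕ} {ω : Comp} {a : Fin d → ℝ} {F : ℝ → ℝ[X]}
    (hF : PT F (𝓝[>] 0) (polyOf d a)) (hm : ∀ t, (F t).Monic) (hd : ∀ t, (F t).natDegree = d)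
    (hp : ∀ᶠ t in 𝓝[>] (0 : ℝ), hasPattern (F t) ω) : a ∈ closure (Sset d ω) := by
  refine mem_closure_of_tendsto (f := fun t (i : Fin d) => (F t).coeff i) (b := 𝓝[>] (0 : ℝ)) ?_ ?_
  · rw [tendsto_pi_nhds]
    intro i
    have := hF i
    rwa [polyOf_coeff] at this
  · filter_upwards [hp] with t ht
    show hasPattern _ _
    rwa [polyOf_eq (hm t) (hd t)]


/-! ### First inclusion: one step -/

lemma merge_decomp (y : Comp) : ∀ k, k + 2 ≤ y.length →
    ∃ L a b R, y = L ++ a :: b :: R ∧ mergeAux y k = L ++ (a + b) :: R := by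
  induction y with
  | nil => intro k hk; simp at hk
  | cons c t ih =>
    intro k hk
    cases k with
    | zero =>
      cases t with
      | nil => simp at hk
      | cons b t => exact ⟨[], c, b, t, rfl, rfl⟩
    | succ k =>
      obtain ⟨L, a, b, R, e1, e2⟩ := ih k (by simp at hk; omega)
      refine ⟨c :: L, a, b, R, by simp [e1], ?_⟩
      rw [mergeAux, e2]
      rfl

lemma mergeAux_append (L : Comp) (a b : PNat) (R : Comp) :
    mergeAux (L ++ a :: b :: R) L.length = L ++ (a + b) :: R := by
  induction L with
  | nil => rfl
  | cons c t ih =>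
    show mergeAux (c :: (t ++ a :: b :: R)) (t.length + 1) = _
    rw [mergeAux, ih]
    rfl

lemma step_merge {d : ℕ} {L R : Comp} {a b : PNat} {z : Fin d → ℝ}
    (h : z ∈ Sset d (L ++ (a + b) :: R)) : z ∈ closure (Sset d (L ++ a :: b :: R)) := by
  obtain ⟨l, hl, hs, Q, hQ, e⟩ := of_hasPattern' (show hasPattern _ _ from h)
  rw [List.map_eq_append_iff] at hl
  obtain ⟨l1, l2', rfl, rfl, h2⟩ := hl
  rw [List.map_eq_cons_iff] at h2
  obtain ⟨⟨r, m⟩, l2, rfl, hm, rfl⟩ := h2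
  simp only at hm
  subst hm
  have hz := polyOf_monic d z
  have hzd := polyOf_natDegree d z
  have hQm : Q.Monic := by
    rw [e] at hz
    exact (W_monic _).of_mul_monic_left hz
  let F : ℝ → ℝ[X] := fun t => W (l1 ++ (r, a) :: (r + t, b) :: l2) * Q
  have hFe : ∀ t, F t = (W l1 * (X - C r) ^ (a : ℕ)) * (X - C (r + t)) ^ (b : ℕ) * (W l2 * Q) := by
    intro t
    simp only [F, W_append, W_cons]
    ring
  have he : polyOf d z =
      (W l1 * (X - C r) ^ (a : ℕ)) * (X - C r) ^ (b : ℕ) * (W l2 * Q) := by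
    rw [e]
    simp only [W_append, W_cons, PNat.add_coe, pow_add]
    ring
  have hlim : Tendsto (fun t : ℝ => r + t) (𝓝[>] 0) (𝓝 r) := by
    have : Tendsto (fun t : ℝ => r + t) (𝓝 0) (𝓝 (r + 0)) := by
      exact (continuous_const.add continuous_id).tendsto 0
    rw [add_zero] at this
    exact this.mono_left nhdsWithin_le_nhds
  refine mem_closure_of (F := F) ?_ ?_ ?_ ?_
  · rw [he]
    simp only [funext hFe]
    exact ((PT.const _).mul ((PT.X_sub_C hlim).pow _)).mul (PT.const _)
  · intro t
    exact (W_monic _).mul hQm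
  · intro t
    rw [← hzd, he, hFe]
    have m1 : (W l1 * (X - C r) ^ (a : ℕ)).Monic := (W_monic _).mul ((monic_X_sub_C _).pow _)
    have m2 : (W l2 * Q).Monic := (W_monic _).mul hQm
    have m3 (s : ℝ) : ((X - C s) ^ (b : ℕ)).Monic := (monic_X_sub_C _).pow _
    rw [(m1.mul (m3 _)).natDegree_mul m2, (m1.mul (m3 _)).natDegree_mul m2,
      m1.natDegree_mul (m3 _), m1.natDegree_mul (m3 _), natDegree_pow, natDegree_pow,
      natDegree_X_sub_C, natDegree_X_sub_C]
  · have h1 : ∀ᶠ t in 𝓝[>] (0 : ℝ), ∀ q ∈ l2, r + t < q.1 := by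
      refine (eventually_all_finite (List.finite_toSet l2)).2 ?_
      intro q hq
      have : r < q.1 := by
        rw [List.pairwise_append, List.pairwise_cons] at hs
        exact hs.2.1.1 q hq
      exact hlim.eventually_lt_const this
    filter_upwards [h1, self_mem_nhdsWithin] with t ht ht0
    have ht0 : 0 < t := ht0
    have := hasPattern_of (l := l1 ++ (r, a) :: (r + t, b) :: l2) ?_ hQ
    · simpa using this
    · simp only [List.pairwise_append, List.pairwise_cons, List.mem_cons] at hs ⊢
      refine ⟨hs.1, ⟨?_, ⟨fun q hq => ht q hq, hs.2.1.2⟩⟩, ?_⟩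
      · rintro q (rfl | hq)
        · simpa using ht0
        · exact hs.2.1.1 q hq
      · rintro p hp q (rfl | rfl | hq)
        · exact hs.2.2 p hp (r, a + b) (Or.inl rfl)
        · have := hs.2.2 p hp (r, a + b) (Or.inl rfl)
          simp only at this ⊢
          linarith
        · exact hs.2.2 p hp _ (Or.inr hq)

lemma step_insert {d : ℕ} {L R : Comp} {z : Fin d → ℝ}
    (h : z ∈ Sset d (L ++ 2 :: R)) : z ∈ closure (Sset d (L ++ R)) := by
  obtain ⟨l, hl, hs, Q, hQ, e⟩ := of_hasPattern' (show hasPattern _ _ from h)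
  rw [List.map_eq_append_iff] at hl
  obtain ⟨l1, l2', rfl, rfl, h2⟩ := hl
  rw [List.map_eq_cons_iff] at h2
  obtain ⟨⟨r, m⟩, l2, rfl, hm, rfl⟩ := h2
  simp only at hm
  subst hm
  have hz := polyOf_monic d z
  have hzd := polyOf_natDegree d z
  have hQm : Q.Monic := by
    rw [e] at hz
    exact (W_monic _).of_mul_monic_left hz
  let F : ℝ → ℝ[X] := fun t => W (l1 ++ l2) * (((X - C r) ^ 2 + C t) * Q)
  have he : polyOf d z = W (l1 ++ l2) * (((X - C r) ^ 2 + C 0) * Q) := by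
    rw [e]
    simp only [W_append, W_cons, C_0, add_zero, PNat.val_ofNat]
    ring
  have m0 : ((X - C r) ^ 2 : ℝ[X]).Monic := (monic_X_sub_C r).pow 2
  have hdeg (t : ℝ) : (C t).degree < ((X - C r) ^ 2 : ℝ[X]).degree := by
    refine degree_C_le.trans_lt ?_
    rw [degree_pow, degree_X_sub_C]
    norm_num
  have m1 (t : ℝ) : ((X - C r) ^ 2 + C t).Monic := m0.add_of_left (hdeg t)
  have hlim : Tendsto (fun t : ℝ => t) (𝓝[>] 0) (𝓝 0) := tendsto_id.mono_left nhdsWithin_le_nhds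
  refine mem_closure_of (F := F) ?_ ?_ ?_ ?_
  · rw [he]
    exact (PT.const _).mul (((PT.const _).add (PT.C hlim)).mul (PT.const _))
  · intro t
    exact (W_monic _).mul ((m1 t).mul hQm)
  · intro t
    rw [← hzd, he]
    simp only [F]
    rw [(W_monic _).natDegree_mul ((m1 t).mul hQm), (W_monic _).natDegree_mul ((m1 0).mul hQm),
      (m1 t).natDegree_mul hQm, (m1 0).natDegree_mul hQm,
      natDegree_add_eq_left_of_degree_lt (hdeg t), natDegree_add_eq_left_of_degree_lt (hdeg 0)]
  · filter_upwards [self_mem_nhdsWithin] with t ht0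
    have ht0 : 0 < t := ht0
    have := hasPattern_of (l := l1 ++ l2) (Q := ((X - C r) ^ 2 + C t) * Q) ?_ ?_
    · simpa using this
    · simp only [List.pairwise_append, List.pairwise_cons, List.mem_cons] at hs ⊢
      exact ⟨hs.1, hs.2.1.2, fun p hp q hq => hs.2.2 p hp q (Or.inr hq)⟩
    · intro y hy
      rw [root_mul] at hy
      refine hy.elim ?_ (hQ y)
      intro h
      simp only [IsRoot.def, eval_add, eval_pow, eval_sub, eval_X, eval_C] at h
      nlinarith [sq_nonneg (y - r)]

lemma step {d : ℕ} {y x : Comp} (h : cstep y x) : Sset d x ⊆ closure (Sset d y) := by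
  intro z hz
  rcases h with ⟨k, hk, rfl⟩ | ⟨k, hk, rfl⟩
  · obtain ⟨L, a, b, R, rfl, e2⟩ := merge_decomp y k hk
    rw [e2] at hz
    exact step_merge hz
  · have := step_insert (L := y.take k) (R := y.drop k) hz
    rwa [List.take_append_drop] at this

lemma incl1 {d : ℕ} {ω ω' : Comp} (h : cprec ω' ω) : Sset d ω' ⊆ closure (Sset d ω) := by
  unfold cprec at h
  induction h with
  | refl => exact subset_closure
  | tail _ h2 ih => exact (step h2).trans (closure_minimal ih isClosed_closure)

/-! ### Second inclusion -/

lemma cstep_cons (c : PNat) {y x : Comp} (h : cstep y x) : cstep (c :: y) (c :: x) := by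
  rcases h with ⟨k, hk, rfl⟩ | ⟨k, hk, rfl⟩
  · refine Or.inl ⟨k + 1, by simp; omega, ?_⟩
    rw [mergeAux]
  · exact Or.inr ⟨k + 1, by simp; omega, by simp [insertC]⟩

lemma cprec_cons (c : PNat) {y x : Comp} (h : cprec x y) : cprec (c :: x) (c :: y) := by
  unfold cprec at *
  induction h with
  | refl => exact Relation.ReflTransGen.refl
  | tail _ h2 ih => exact ih.tail (cstep_cons c h2)

lemma strictify (l : List (ℝ × PNat)) (hl : l.Pairwise fun p q => p.1 ≤ q.1) :
    ∃ l' : List (ℝ × PNat), (l'.Pairwise fun p q => p.1 < q.1) ∧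
      cprec (l'.map Prod.snd) (l.map Prod.snd) ∧ W l = W l' ∧
      ∀ q ∈ l', ∃ p ∈ l, q.1 = p.1 := by
  induction l with
  | nil => exact ⟨[], by simp, Relation.ReflTransGen.refl, rfl, by simp⟩
  | cons p t ih =>
    rw [List.pairwise_cons] at hl
    obtain ⟨t', h1, h2, h3, h4⟩ := ih hl.2
    have h2' := cprec_cons p.2 h2
    have hge : ∀ q ∈ t', p.1 ≤ q.1 := by
      intro q hq
      obtain ⟨s, hs, e⟩ := h4 q hq
      rw [e]
      exact hl.1 s hs
    have h4' : ∀ q ∈ t', ∃ s ∈ p :: t, q.1 = s.1 := by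
      intro q hq
      obtain ⟨s, hs, e⟩ := h4 q hq
      exact ⟨s, by simp [hs], e⟩
    cases t' with
    | nil =>
      refine ⟨[p], by simp, h2', by rw [W_cons, h3, W_cons], ?_⟩
      intro q hq
      exact ⟨p, by simp, by simp at hq; rw [hq]⟩
    | cons q u =>
      have hu := List.pairwise_cons.1 h1
      rcases (hge q (by simp)).lt_or_eq with hlt | heq
      · refine ⟨p :: q :: u, ?_, h2', by rw [W_cons, h3, W_cons p], ?_⟩
        · rw [List.pairwise_cons]
          refine ⟨?_, h1⟩
          intro s hs
          rcases List.mem_cons.1 hs with rfl | hs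
          · exact hlt
          · exact hlt.trans (hu.1 s hs)
        · intro s hs
          rcases List.mem_cons.1 hs with rfl | hs
          · exact ⟨s, by simp, rfl⟩
          · exact h4' s hs
      · refine ⟨(p.1, p.2 + q.2) :: u, ?_, ?_, ?_, ?_⟩
        · rw [List.pairwise_cons]
          refine ⟨?_, hu.2⟩
          intro s hs
          simp only [heq]
          exact hu.1 s hs
        · refine Relation.ReflTransGen.tail h2' (Or.inl ⟨0, by simp, rfl⟩)
        · rw [W_cons, h3, W_cons, W_cons, ← heq, PNat.add_coe, pow_add]
          ring
        · intro s hs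
          rcases List.mem_cons.1 hs with rfl | hs
          · exact ⟨p, by simp, rfl⟩
          · exact h4' s (by simp [hs])

lemma split_at (l : List (ℝ × PNat)) (hl : l.Pairwise fun p q => p.1 ≤ q.1) (r : ℝ) :
    ∃ l1 l2, l = l1 ++ l2 ∧ (∀ p ∈ l1, p.1 ≤ r) ∧ ∀ p ∈ l2, r ≤ p.1 := by
  induction l with
  | nil => exact ⟨[], [], by simp⟩
  | cons p t ih =>
    rw [List.pairwise_cons] at hl
    by_cases h : p.1 ≤ r
    · obtain ⟨l1, l2, rfl, h1, h2⟩ := ih hl.2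
      refine ⟨p :: l1, l2, rfl, ?_, h2⟩
      intro q hq
      rcases List.mem_cons.1 hq with rfl | hq
      · exact h
      · exact h1 q hq
    · refine ⟨[], p :: t, rfl, by simp, ?_⟩
      intro q hq
      rcases List.mem_cons.1 hq with rfl | hq
      · exact (not_le.1 h).le
      · exact (not_le.1 h).le.trans (hl.1 q hq)

lemma extract_sq {Q : ℝ[X]} (h : ∀ y, 0 ≤ Q.eval y) {r : ℝ} (hr : Q.IsRoot r) :
    ∃ Q', Q = (X - C r) ^ 2 * Q' ∧ ∀ y, 0 ≤ Q'.eval y := by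
  obtain ⟨Q1, rfl⟩ := dvd_iff_isRoot.2 hr
  have hmin : IsLocalMin (fun y => ((X - C r) * Q1).eval y) r := by
    refine Eventually.of_forall fun y => ?_
    show ((X - C r) * Q1).eval r ≤ _
    rw [hr]
    exact h y
  have h1 := hmin.deriv_eq_zero
  rw [Polynomial.deriv] at h1
  have hr1 : Q1.IsRoot r := by
    simpa using h1
  obtain ⟨Q2, rfl⟩ := dvd_iff_isRoot.2 hr1
  refine ⟨Q2, by ring, ?_⟩
  have hcl : IsClosed {y | 0 ≤ Q2.eval y} := isClosed_le continuous_const Q2.continuous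
  have hsub : ({r}ᶜ : Set ℝ) ⊆ {y | 0 ≤ Q2.eval y} := by
    intro y hy
    have hy : y ≠ r := hy
    have h2 := h y
    have h3 : 0 < (y - r) ^ 2 := by
      have : y - r ≠ 0 := sub_ne_zero.2 hy
      positivity
    have h4 : eval y ((X - C r) * ((X - C r) * Q2)) = (y - r) ^ 2 * Q2.eval y := by
      simp; ring
    rw [h4] at h2
    exact nonneg_of_mul_nonneg_right h2 h3
  have hd : Dense ({r}ᶜ : Set ℝ) := dense_compl_singleton r
  intro y
  have : y ∈ closure ({r}ᶜ : Set ℝ) := hd y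
  exact closure_minimal hsub hcl this

lemma descent (n : ℕ) : ∀ (Q : ℝ[X]) (l : List (ℝ × PNat)), Q.natDegree ≤ n → Q ≠ 0 →
    (∀ y, 0 ≤ Q.eval y) → (l.Pairwise fun p q => p.1 ≤ q.1) →
    ∃ l' Q', (l'.Pairwise fun p q => p.1 ≤ q.1) ∧ cprec (l'.map Prod.snd) (l.map Prod.snd) ∧
      (∀ y, ¬ IsRoot Q' y) ∧ W l * Q = W l' * Q' := by
  induction n with
  | zero =>
    intro Q l hd h0 hn hl
    refine ⟨l, Q, hl, Relation.ReflTransGen.refl, ?_, rfl⟩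
    rw [Nat.le_zero, natDegree_eq_zero] at hd
    obtain ⟨c, rfl⟩ := hd
    intro y hy
    simp at hy
    simp [hy] at h0
  | succ n ih =>
    intro Q l hd h0 hn hl
    by_cases hr : ∃ r, Q.IsRoot r
    · obtain ⟨r, hr⟩ := hr
      obtain ⟨Q', rfl, hn'⟩ := extract_sq hn hr
      have h0' : Q' ≠ 0 := right_ne_zero_of_mul h0
      obtain ⟨l1, l2, rfl, h1, h2⟩ := split_at l hl r
      have hdeg : Q'.natDegree ≤ n := by
        rw [((monic_X_sub_C r).pow 2).natDegree_mul' h0', natDegree_pow, natDegree_X_sub_C] at hd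
        omega
      obtain ⟨l', Q'', hl', hc, hQ'', e⟩ := ih Q' (l1 ++ (r, 2) :: l2) hdeg h0' hn' (by
        rw [List.pairwise_append] at hl
        rw [List.pairwise_append, List.pairwise_cons]
        refine ⟨hl.1, ⟨h2, hl.2.1⟩, ?_⟩
        intro p hp q hq
        rcases List.mem_cons.1 hq with rfl | hq
        · exact h1 p hp
        · exact hl.2.2 p hp q hq)
      refine ⟨l', Q'', hl', ?_, hQ'', ?_⟩
      · refine Relation.ReflTransGen.head ?_ hc
        refine Or.inr ⟨l1.length, by simp, ?_⟩
        simp [insertC]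
      · rw [← e]
        simp only [W_append, W_cons, PNat.val_ofNat]
        ring
    · exact ⟨l, Q, hl, Relation.ReflTransGen.refl, fun y hy => hr ⟨y, hy⟩, rfl⟩

lemma nonneg_of_noroot {Q : ℝ[X]} (hm : Q.Monic) (hQ : ∀ y, ¬ Q.IsRoot y) (y : ℝ) :
    0 ≤ Q.eval y := by
  by_contra hneg
  rw [not_le] at hneg
  rcases Nat.eq_zero_or_pos Q.natDegree with h0 | hpos
  · rw [hm.natDegree_eq_zero.1 h0] at hneg
    simp at hneg
    linarith
  · have ht := tendsto_atTop_of_leadingCoeff_nonneg Q (natDegree_pos_iff_degree_pos.1 hpos)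
      (by rw [hm.leadingCoeff]; exact zero_le_one)
    obtain ⟨z, hz1, hz2⟩ := ((ht.eventually_ge_atTop 0).and (eventually_ge_atTop y)).exists
    obtain ⟨w, _, hw⟩ := intermediate_value_Icc hz2 Q.continuous.continuousOn ⟨hneg.le, hz1⟩
    exact hQ w hw

lemma root_bound {d : ℕ} {b : Fin d → ℝ} {M : ℝ} (hM : 0 ≤ M) (hb : ‖b‖ ≤ M) {r : ℝ}
    (hr : (polyOf d b).IsRoot r) : ‖r‖ ≤ M + 1 := by
  have h := IsRoot.norm_lt_cauchyBound (polyOf_monic d b).ne_zero hr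
  refine (show ‖r‖ ≤ ((cauchyBound (polyOf d b) : NNReal) : ℝ) from h.le).trans ?_
  rw [cauchyBound, (polyOf_monic d b).leadingCoeff, polyOf_natDegree]
  have : ((Finset.range d).sup fun x => ‖(polyOf d b).coeff x‖₊) ≤ M.toNNReal := by
    refine Finset.sup_le fun i hi => ?_
    have hi := Finset.mem_range.1 hi
    rw [show (polyOf d b).coeff i = b ⟨i, hi⟩ from polyOf_coeff d b ⟨i, hi⟩,
      ← NNReal.coe_le_coe, Real.coe_toNNReal _ hM]
    exact (norm_le_pi_norm b _).trans hb
  have h2 : (((Finset.range d).sup fun x => ‖(polyOf d b).coeff x‖₊ : NNReal) : ℝ) ≤ M := by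
    rw [← NNReal.coe_le_coe, Real.coe_toNNReal _ hM] at this
    exact this
  simpa using h2

lemma incl2 {d : ℕ} {ω : Comp} {a : Fin d → ℝ} (ha : a ∈ closure (Sset d ω)) :
    ∃ ω', cprec ω' ω ∧ a ∈ Sset d ω' := by
  rw [mem_closure_iff_comap_neBot] at ha
  let u : Ultrafilter (Sset d ω) := Ultrafilter.of (comap Subtype.val (𝓝 a))
  have hu : Tendsto (fun b : Sset d ω => (b : Fin d → ℝ)) u (𝓝 a) :=
    tendsto_comap.mono_left (Ultrafilter.of_le _)
  choose x hx Q hQ e using fun b : Sset d ω => of_hasPattern (show hasPattern _ _ from b.2)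
  have hQm : ∀ b, (Q b).Monic := by
    intro b
    have := polyOf_monic d b
    rw [e] at this
    exact (W_monic _).of_mul_monic_left this
  -- convergence of the roots
  obtain ⟨y, hy⟩ : ∃ y, Tendsto x u (𝓝 y) := by
    have hb : ∀ᶠ b : Sset d ω in u, ‖(b : Fin d → ℝ)‖ ≤ ‖a‖ + 1 := by
      filter_upwards [hu.norm.eventually_lt_const (lt_add_one ‖a‖)] with b hb
      exact hb.le
    have hc : IsCompact (Metric.closedBall (0 : Fin ω.length → ℝ) (‖a‖ + 1 + 1)) :=
      isCompact_closedBall _ _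
    have hmem : ∀ᶠ b in u, x b ∈ Metric.closedBall (0 : Fin ω.length → ℝ) (‖a‖ + 1 + 1) := by
      filter_upwards [hb] with b hb
      rw [mem_closedBall_zero_iff, pi_norm_le_iff_of_nonneg (by positivity)]
      intro i
      refine root_bound (by positivity) hb ?_
      rw [e b, root_mul]
      left
      have : (x b i, ω.get i) ∈ List.ofFn fun i => (x b i, ω.get i) :=
        (List.mem_ofFn' _ _).2 ⟨i, rfl⟩
      rw [← rootMultiplicity_pos (W_monic _).ne_zero]
      have hl : (List.ofFn fun i => (x b i, ω.get i)).Pairwise fun p q => p.1 < q.1 := by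
        rw [List.pairwise_ofFn]
        intro i j hij
        exact hx b hij
      rw [W_mult hl this]
      exact (ω.get i).pos
    obtain ⟨y, _, hy⟩ := hc.ultrafilter_le_nhds (u.map x) (by
      rw [le_principal_iff]
      exact hmem)
    exact ⟨y, hy⟩
  have hyi := tendsto_pi_nhds.1 hy
  have hmono : Monotone y := by
    intro i j hij
    exact le_of_tendsto_of_tendsto' (hyi i) (hyi j) fun b => (hx b).monotone hij
  have hW (z : Fin ω.length → ℝ) : W (List.ofFn fun i => (z i, ω.get i)) =
      ((List.finRange ω.length).map fun i => (X - C (z i)) ^ (ω.get i : ℕ)).prod := by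
    simp [W, List.map_ofFn, List.ofFn_eq_map, Function.comp_def]
  have hP := PT_polyOf d hu
  have hdeg : ∀ b : Sset d ω, (polyOf d b).natDegree ≤ d := fun b => (polyOf_natDegree d b).le
  simp only [e, hW] at hP hdeg
  obtain ⟨R, hR, hPR⟩ := PT.divlist hyi (fun i => (ω.get i : ℕ)) _ hP hdeg
  have hQd : ∀ b, (Q b).natDegree ≤ d := fun b =>
    natDegree_aux _ _ (by rw [← hW]; exact W_monic _) (hdeg b)
  have hRn : ∀ t, 0 ≤ R.eval t := fun t =>
    ge_of_tendsto' (hR.eval hQd (hR.natDegree_le hQd) tendsto_const_nhds)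
      fun b => nonneg_of_noroot (hQm b) (hQ b) t
  have hR0 : R ≠ 0 := by
    rintro rfl
    rw [mul_zero] at hPR
    exact (polyOf_monic d a).ne_zero hPR
  rw [← hW] at hPR
  obtain ⟨l', Q', h1, h2, h3, h4⟩ := descent _ R (List.ofFn fun i => (y i, ω.get i)) le_rfl hR0 hRn
    (by
      rw [List.pairwise_ofFn]
      intro i j hij
      exact hmono hij.le)
  obtain ⟨l'', k1, k2, k3, _⟩ := strictify l' h1
  refine ⟨l''.map Prod.snd, ?_, ?_⟩
  · have h5 := Relation.ReflTransGen.trans h2 k2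
    rw [List.map_ofFn] at h5
    have h6 : List.ofFn (Prod.snd ∘ fun i => (y i, ω.get i)) = ω := List.ofFn_get ω
    rwa [h6] at h5
  · show hasPattern _ _
    rw [hPR, h4, k3]
    exact hasPattern_of k1 h3

end CS


/-- For `d ≥ 1` and a composition `ω` with `|ω| ≤ d`, `|ω| ≡ d (mod 2)`,
the closure of `S_d(ω)` in `ℝ^d` is the union of the `S_d(ω')` over all `ω' ⪯ ω`. -/
theorem closure_of_stratum (d : ℕ) (hd : 1 ≤ d) (ω : Comp) (h1 : normC ω ≤ d)
    (h2 : normC ω % 2 = d % 2) :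
    closure (Sset d ω) = ⋃ ω' ∈ {w : Comp | cprec w ω}, Sset d ω' := by
  ext a
  simp only [Set.mem_iUnion, Set.mem_ofPred_eq, exists_prop]
  constructor
  · exact CS.incl2
  · rintro ⟨ω', h, ha⟩
    exact CS.incl1 h ha
end

section
/- Let d ≥ 1 and let Θ be a set of compositions ω with |ω| ≤ d and |ω| ≡ d (mod 2). Then the union ⋃_{ω∈Θ} S_d(ω) is a closed subset of ℝ^d if and only if for every ω ∈ Θ and every composition ω' with ω' ⪯ ω and |ω'| ≤ d one has ω' ∈ Θ. -/
namespace PatProof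
open Polynomial Filter Topology

/-- product of root factors -/
noncomputable def R (L : List (ℝ × PNat)) : ℝ[X] :=
  (L.map fun p => (X - C p.1) ^ (p.2 : ℕ)).prod

def wk (L : List (ℝ × PNat)) : Prop := L.Pairwise fun p q => p.1 ≤ q.1
def st (L : List (ℝ × PNat)) : Prop := L.Pairwise fun p q => p.1 < q.1

@[simp] lemma R_nil : R [] = 1 := by simp [R]
@[simp] lemma R_cons (p) (L) : R (p :: L) = (X - C p.1) ^ (p.2 : ℕ) * R L := by simp [R]
@[simp] lemma R_append (L M) : R (L ++ M) = R L * R M := by simp [R]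

lemma R_monic (L) : (R L).Monic := by
  induction L with
  | nil => simp
  | cons p L ih => rw [R_cons]; exact ((monic_X_sub_C _).pow _).mul ih

lemma R_natDegree (L) : (R L).natDegree = normC (L.map Prod.snd) := by
  induction L with
  | nil => simp [normC]
  | cons p L ih =>
    rw [R_cons, ((monic_X_sub_C _).pow _).natDegree_mul (R_monic L), ih]
    simp [normC]

lemma R_root (L) (y : ℝ) : (R L).IsRoot y ↔ ∃ p ∈ L, p.1 = y := by
  induction L with
  | nil => simp [IsRoot]
  | cons p L ih =>
    rw [R_cons, root_mul, ih]
    simp [IsRoot, sub_eq_zero, eq_comm (a := y)]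

lemma R_mult (L) (hL : st L) : ∀ p ∈ L, rootMultiplicity p.1 (R L) = p.2 := by
  induction L with
  | nil => simp
  | cons q L ih =>
    have hL' := List.pairwise_cons.1 hL
    intro p hp
    rw [R_cons, rootMultiplicity_mul (((monic_X_sub_C _).pow _).mul (R_monic L)).ne_zero]
    rcases List.mem_cons.1 hp with rfl | hp
    · rw [rootMultiplicity_X_sub_C_pow, rootMultiplicity_eq_zero, add_zero]
      rw [R_root]
      rintro ⟨r, hr, h⟩
      have := hL'.1 r hr
      linarith
    · rw [ih hL'.2 p hp, rootMultiplicity_eq_zero, zero_add]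
      have := hL'.1 p hp
      simp [IsRoot, sub_eq_zero]
      intro h; linarith

/-- factorization form -/
def fac (P : ℝ[X]) (L : List (ℝ × PNat)) : Prop :=
  st L ∧ ∃ Q : ℝ[X], (∀ y, ¬ Q.IsRoot y) ∧ P = R L * Q

lemma fac_mem {P L} (h : fac P L) (p : ℝ × PNat) :
    p ∈ L ↔ P.IsRoot p.1 ∧ rootMultiplicity p.1 P = p.2 := by
  obtain ⟨hs, Q, hQ, rfl⟩ := h
  have hQ0 : Q ≠ 0 := by rintro rfl; exact hQ 0 (by simp)
  have key : ∀ y, rootMultiplicity y (R L * Q) = rootMultiplicity y (R L) := by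
    intro y
    rw [rootMultiplicity_mul (mul_ne_zero (R_monic L).ne_zero hQ0),
      rootMultiplicity_eq_zero (hQ y), add_zero]
  rw [key, root_mul, R_root]
  constructor
  · intro hp; exact ⟨Or.inl ⟨p, hp, rfl⟩, R_mult L hs p hp⟩
  · rintro ⟨h | h, h2⟩
    · obtain ⟨q, hq, hqp⟩ := h
      have := R_mult L hs q hq
      rw [hqp, h2] at this
      have : p = q := Prod.ext hqp.symm (PNat.coe_injective this)
      exact this ▸ hq
    · exact absurd h (hQ _)

lemma fac_unique {P L M} (h : fac P L) (h' : fac P M) : L = M := by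
  have hL := h.1
  have hM := h'.1
  have nL : L.Nodup := hL.imp (fun h e => by rw [e] at h; exact lt_irrefl _ h)
  have nM : M.Nodup := hM.imp (fun h e => by rw [e] at h; exact lt_irrefl _ h)
  have hp : L.Perm M := (List.perm_ext_iff_of_nodup nL nM).2 fun p => by
    rw [fac_mem h, fac_mem h']
  refine List.Perm.eq_of_pairwise ?_ hL hM hp
  intro a b _ _ h1 h2
  exact absurd h1 (lt_asymm h2)

lemma pattern_of_fac {P L} (h : fac P L) : hasPattern P (L.map Prod.snd) := by
  have hm := fac_mem h
  obtain ⟨hs, Q, hQ, hP⟩ := h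
  have hQ0 : Q ≠ 0 := by rintro rfl; exact hQ 0 (by simp)
  refine ⟨hP ▸ mul_ne_zero (R_monic L).ne_zero hQ0,
    fun i => (L.get (i.cast (by simp))).1, ?_, ?_, ?_⟩
  · intro i j hij
    exact List.pairwise_iff_get.1 hs _ _ (by simpa using hij)
  · intro i
    have := ((hm _).1 (List.get_mem L (i.cast (by simp)))).2
    rw [this]; simp
  · intro y hy
    rw [hP, root_mul, R_root] at hy
    rcases hy with ⟨p, hp, rfl⟩ | hy
    · obtain ⟨i, hi⟩ := List.get_of_mem hp
      exact ⟨i.cast (by simp), by simp [← hi]⟩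
    · exact absurd hy (hQ y)

lemma fac_of_pattern {P ω} (h : hasPattern P ω) : ∃ L, L.map Prod.snd = ω ∧ fac P L := by
  obtain ⟨h0, x, hx, hm, hr⟩ := h
  refine ⟨List.ofFn fun i => (x i, ω.get i), ?_, ?_, ?_⟩
  · rw [List.map_ofFn]; exact List.ofFn_get ω
  · rw [st, List.pairwise_ofFn]; intro i j hij; exact hx hij
  · have hRe : R (List.ofFn fun i => (x i, ω.get i)) =
        ∏ i, (X - C (x i)) ^ (ω.get i : ℕ) := by
      rw [R, List.map_ofFn, List.prod_ofFn]; rfl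
    have hd : (∏ i, (X - C (x i)) ^ (ω.get i : ℕ)) ∣ P := by
      apply Finset.prod_dvd_of_coprime
      · intro i _ j _ hij
        exact (pairwise_coprime_X_sub_C hx.injective hij).pow
      · intro i _
        rw [← hm i]; exact pow_rootMultiplicity_dvd P (x i)
    obtain ⟨Q, hQ⟩ := hd
    refine ⟨Q, ?_, by rw [hRe, hQ]⟩
    intro y hy
    obtain ⟨i, rfl⟩ := hr y (by rw [hQ, root_mul]; exact Or.inr hy)
    have h1 : (X - C (x i)) ^ ((ω.get i : ℕ) + 1) ∣ P := by
      rw [hQ, pow_succ]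
      exact mul_dvd_mul (Finset.dvd_prod_of_mem (fun i => (X - C (x i)) ^ (ω.get i : ℕ)) (Finset.mem_univ i)) (dvd_iff_isRoot.2 hy)
    have := (le_rootMultiplicity_iff h0).2 h1
    rw [hm i] at this
    omega

lemma pattern_unique {P ω ω'} (h : hasPattern P ω) (h' : hasPattern P ω') : ω = ω' := by
  obtain ⟨L, rfl, hL⟩ := fac_of_pattern h
  obtain ⟨M, rfl, hM⟩ := fac_of_pattern h'
  rw [fac_unique hL hM]

/-! combinatorics of steps -/

lemma merge_spec (l1 : Comp) (a b l2) :
    mergeAux (l1 ++ a :: b :: l2) l1.length = l1 ++ (a + b) :: l2 := by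
  induction l1 with
  | nil => simp [mergeAux]
  | cons c l1 ih =>
    simp only [List.cons_append, List.length_cons]
    cases l1 <;> simp [mergeAux] at ih ⊢
    exact ih

lemma insert_spec (l1 l2 : Comp) : insertC (l1 ++ l2) l1.length = l1 ++ 2 :: l2 := by
  simp [insertC]

lemma cstep_iff (y x : Comp) : cstep y x ↔
    (∃ l1 a b l2, y = l1 ++ a :: b :: l2 ∧ x = l1 ++ (a + b) :: l2) ∨
    ∃ l1 l2, y = l1 ++ l2 ∧ x = l1 ++ 2 :: l2 := by
  constructor
  · rintro (⟨k, hk, rfl⟩ | ⟨k, hk, rfl⟩)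
    · left
      refine ⟨y.take k, y[k], y[k+1], y.drop (k+2), ?_, ?_⟩
      · simp
      · have h1 : y = y.take k ++ y[k] :: y[k+1] :: y.drop (k+2) := by simp
        have h2 : (y.take k).length = k := by simp; omega
        have := merge_spec (y.take k) y[k] y[k+1] (y.drop (k+2))
        rw [h2, ← h1] at this
        exact this
    · right
      exact ⟨y.take k, y.drop k, by simp, rfl⟩
  · rintro (⟨l1, a, b, l2, rfl, rfl⟩ | ⟨l1, l2, rfl, rfl⟩)
    · exact Or.inl ⟨l1.length, by simp, (merge_spec ..).symm⟩
    · exact Or.inr ⟨l1.length, by simp, (insert_spec ..).symm⟩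

lemma cprec_cons (c) {x y : Comp} (h : cprec x y) : cprec (c :: x) (c :: y) := by
  refine Relation.ReflTransGen.lift (c :: ·) ?_ _ _ h
  intro a b hab
  change cstep (c :: a) (c :: b)
  rw [cstep_iff] at hab ⊢
  rcases hab with ⟨l1, a, b, l2, rfl, rfl⟩ | ⟨l1, l2, rfl, rfl⟩
  · exact Or.inl ⟨c :: l1, a, b, l2, rfl, rfl⟩
  · exact Or.inr ⟨c :: l1, l2, rfl, rfl⟩

lemma cstep_norm {y x : Comp} (h : cstep y x) :
    normC y ≤ normC x ∧ normC y % 2 = normC x % 2 := by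
  rw [cstep_iff] at h
  rcases h with ⟨l1, a, b, l2, rfl, rfl⟩ | ⟨l1, l2, rfl, rfl⟩
  · simp [normC]; omega
  · simp [normC]; omega

lemma finite_norm (d : ℕ) : {ω : Comp | normC ω ≤ d}.Finite := by
  induction d with
  | zero =>
    refine (Set.finite_singleton []).subset ?_
    intro ω h
    cases ω with
    | nil => rfl
    | cons a t => have := a.pos; simp [normC] at h
  | succ d ih =>
    refine ((Set.finite_singleton []).union
      ((Set.finite_Icc (1 : PNat) (d.succPNat)).image2 List.cons ih)).subset ?_
    intro ω h
    cases ω with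
    | nil => exact Or.inl rfl
    | cons a t =>
      right
      have := a.pos
      simp [normC] at h
      refine ⟨a, ⟨one_le, ?_⟩, t, ?_, rfl⟩
      · rw [← PNat.coe_le_coe]; simp; omega
      · simp [normC]; omega

/-! algebraic collapse -/

lemma merge_all (L) (hL : wk L) : ∃ M, st M ∧ R M = R L ∧
    cprec (M.map Prod.snd) (L.map Prod.snd) ∧ ∀ q ∈ M, ∃ p ∈ L, p.1 = q.1 := by
  induction L with
  | nil => exact ⟨[], by simp [st], rfl, Relation.ReflTransGen.refl, by simp⟩
  | cons p L ih =>
    obtain ⟨hp, hL⟩ := List.pairwise_cons.1 hL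
    obtain ⟨M, hM, hR, hc, hmem⟩ := ih hL
    have hle : ∀ q ∈ M, p.1 ≤ q.1 := by
      intro q hq; obtain ⟨r, hr, h⟩ := hmem q hq; rw [← h]; exact hp r hr
    cases M with
    | nil =>
      refine ⟨[p], by simp [st], by rw [R_cons, R_cons, hR], cprec_cons _ hc, by simp⟩
    | cons q t =>
      obtain ⟨hq, ht⟩ := List.pairwise_cons.1 hM
      rcases (hle q (by simp)).lt_or_eq with h | h
      · refine ⟨p :: q :: t, ?_, by rw [R_cons, R_cons p L, hR], cprec_cons _ hc, ?_⟩
        · refine List.pairwise_cons.2 ⟨?_, hM⟩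
          intro r hr
          rcases List.mem_cons.1 hr with rfl | hr
          · exact h
          · exact h.trans (hq r hr)
        · intro r hr
          rcases List.mem_cons.1 hr with rfl | hr
          · exact ⟨r, by simp, rfl⟩
          · obtain ⟨s, hs, h⟩ := hmem r hr
            exact ⟨s, by simp [hs], h⟩
      · refine ⟨(p.1, p.2 + q.2) :: t, ?_, ?_, ?_, ?_⟩
        · exact List.pairwise_cons.2 ⟨fun r hr => by rw [h]; exact hq r hr, ht⟩
        · rw [R_cons, R_cons p L, ← hR, R_cons, ← h, PNat.add_coe, pow_add, mul_assoc]
        · refine Relation.ReflTransGen.tail (cprec_cons p.2 hc) ?_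
          rw [cstep_iff]
          exact Or.inl ⟨[], p.2, q.2, t.map Prod.snd, rfl, rfl⟩
        · intro r hr
          rcases List.mem_cons.1 hr with rfl | hr
          · exact ⟨p, by simp, rfl⟩
          · obtain ⟨s, hs, h⟩ := hmem r (by simp [hr])
            exact ⟨s, by simp [hs], h⟩

lemma split_at (L) (hL : wk L) (y : ℝ) : ∃ L1 L2, L = L1 ++ L2 ∧
    (∀ p ∈ L1, p.1 ≤ y) ∧ ∀ p ∈ L2, y ≤ p.1 := by
  induction L with
  | nil => exact ⟨[], [], by simp⟩
  | cons p L ih =>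
    obtain ⟨hp, hL⟩ := List.pairwise_cons.1 hL
    rcases le_total p.1 y with h | h
    · obtain ⟨L1, L2, rfl, h1, h2⟩ := ih hL
      refine ⟨p :: L1, L2, rfl, ?_, h2⟩
      intro q hq
      rcases List.mem_cons.1 hq with rfl | hq
      · exact h
      · exact h1 q hq
    · refine ⟨[], p :: L, rfl, by simp, ?_⟩
      intro q hq
      rcases List.mem_cons.1 hq with rfl | hq
      · exact h
      · exact h.trans (hp q hq)

lemma double_root (Q : ℝ[X]) (hQ : ∀ y, 0 ≤ Q.eval y) (y : ℝ) (hy : Q.IsRoot y) :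
    ∃ S : ℝ[X], Q = (X - C y) ^ 2 * S ∧ ∀ z, 0 ≤ S.eval z := by
  obtain ⟨T, hT⟩ := dvd_iff_isRoot.2 hy
  have hd : Q.derivative.eval y = 0 := by
    have hmin : IsLocalMin (fun z => Q.eval z) y := by
      refine Eventually.of_forall fun z => ?_
      show Q.eval y ≤ Q.eval z
      rw [hy.eq_zero]; exact hQ z
    exact hmin.hasDerivAt_eq_zero (Q.hasDerivAt y)
  have hT0 : T.IsRoot y := by
    rw [hT] at hd
    simpa using hd
  obtain ⟨S, hS⟩ := dvd_iff_isRoot.2 hT0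
  have hQS : Q = (X - C y) ^ 2 * S := by rw [hT, hS]; ring
  refine ⟨S, hQS, ?_⟩
  have hcl : IsClosed {z | 0 ≤ S.eval z} := isClosed_le continuous_const S.continuous
  have hsub : ({y}ᶜ : Set ℝ) ⊆ {z | 0 ≤ S.eval z} := by
    intro z hz
    have h1 := hQ z
    rw [hQS] at h1
    simp only [eval_mul, eval_pow, eval_sub, eval_X, eval_C] at h1
    have : 0 < (z - y) ^ 2 := by
      have : z - y ≠ 0 := sub_ne_zero.2 hz
      positivity
    exact nonneg_of_mul_nonneg_right h1 this
  intro z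
  have := hcl.closure_subset_iff.2 hsub
  rw [(dense_compl_singleton y).closure_eq] at this
  exact this (Set.mem_univ z)

lemma collapse (n : ℕ) : ∀ (L : List (ℝ × PNat)) (Q : ℝ[X]), Q.natDegree ≤ n → wk L → Q ≠ 0 →
    (∀ y, 0 ≤ Q.eval y) →
    ∃ M, fac (R L * Q) M ∧ cprec (M.map Prod.snd) (L.map Prod.snd) := by
  induction n using Nat.strong_induction_on with
  | _ n ih =>
  intro L Q hn hL hQ0 hQ
  by_cases hr : ∃ y, Q.IsRoot y
  · obtain ⟨y, hy⟩ := hr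
    obtain ⟨S, hS, hSp⟩ := double_root Q hQ y hy
    obtain ⟨L1, L2, rfl, h1, h2⟩ := split_at L hL y
    have hS0 : S ≠ 0 := by rintro rfl; simp [hS] at hQ0
    have hdeg : Q.natDegree = 2 + S.natDegree := by
      rw [hS, natDegree_mul (pow_ne_zero _ (X_sub_C_ne_zero y)) hS0]; simp
    have hL' : wk (L1 ++ (y, 2) :: L2) := by
      obtain ⟨a, b, c⟩ := List.pairwise_append.1 hL
      refine List.pairwise_append.2 ⟨a, List.pairwise_cons.2 ⟨fun p hp => h2 p hp, b⟩, ?_⟩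
      intro p hp q hq
      rcases List.mem_cons.1 hq with rfl | hq
      · exact h1 p hp
      · exact c p hp q hq
    obtain ⟨M, hM, hc⟩ := ih S.natDegree (by omega) _ S le_rfl hL' hS0 hSp
    refine ⟨M, ?_, ?_⟩
    · convert hM using 1
      rw [hS]; simp; ring
    · refine Relation.ReflTransGen.head ?_ hc
      rw [cstep_iff]
      exact Or.inr ⟨L1.map Prod.snd, L2.map Prod.snd, by simp, by simp⟩
  · push Not at hr
    obtain ⟨M, hM, hR, hc, -⟩ := merge_all L hL
    exact ⟨M, ⟨hM, Q, hr, by rw [hR]⟩, hc⟩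

end PatProof

namespace PatProof
open Polynomial Filter Topology

/-! limits -/

def Conv {α : Type*} (F : Filter α) (d : ℕ) (P : α → ℝ[X]) (P0 : ℝ[X]) : Prop :=
  (∀ᶠ a in F, (P a).natDegree ≤ d) ∧ ∀ k, Tendsto (fun a => (P a).coeff k) F (𝓝 (P0.coeff k))

lemma conv_div {α : Type*} {F : Filter α} [F.NeBot] {d : ℕ} {P S : α → ℝ[X]} {P0 : ℝ[X]}
    {x : α → ℝ} {x0 : ℝ} (hP : Conv F d P P0) (hx : Tendsto x F (𝓝 x0))
    (h : ∀ᶠ a in F, P a = (X - C (x a)) * S a) :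
    ∃ S0, Conv F d S S0 ∧ P0 = (X - C x0) * S0 := by
  have hdeg : ∀ᶠ a in F, (S a).natDegree ≤ d := by
    filter_upwards [hP.1, h] with a h1 h2
    by_cases h0 : S a = 0
    · simp [h0]
    · rw [h2, natDegree_mul (X_sub_C_ne_zero _) h0] at h1
      omega
  have hrec : ∀ k, ∀ᶠ a in F, (S a).coeff k = (P a).coeff (k + 1) + x a * (S a).coeff (k + 1) := by
    intro k
    filter_upwards [h] with a h2
    rw [h2, sub_mul, coeff_sub, coeff_X_mul, coeff_C_mul]; ring
  have hlim : ∀ j k, d + 1 ≤ k + j → ∃ c, Tendsto (fun a => (S a).coeff k) F (𝓝 c) := by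
    intro j
    induction j with
    | zero =>
      intro k hk
      refine ⟨0, tendsto_const_nhds.congr' ?_⟩
      filter_upwards [hdeg] with a ha
      exact (coeff_eq_zero_of_natDegree_lt (by omega)).symm
    | succ j ih =>
      intro k hk
      obtain ⟨c, hc⟩ := ih (k + 1) (by omega)
      refine ⟨_, ((hP.2 (k + 1)).add (hx.mul hc)).congr' ?_⟩
      filter_upwards [hrec k] with a ha using ha.symm
  have hlim' : ∀ k, ∃ c, Tendsto (fun a => (S a).coeff k) F (𝓝 c) :=
    fun k => hlim (d + 1) k (by omega)
  choose c hc using hlim'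
  have hc0 : ∀ k, d < k → c k = 0 := by
    intro k hk
    refine tendsto_nhds_unique (hc k) (tendsto_const_nhds.congr' ?_)
    filter_upwards [hdeg] with a ha
    exact (coeff_eq_zero_of_natDegree_lt (by omega)).symm
  let S0 : ℝ[X] := ∑ k ∈ Finset.range (d + 1), monomial k (c k)
  have hS0 : ∀ k, S0.coeff k = c k := by
    intro k
    simp only [S0, finsetSum_coeff, coeff_monomial, Finset.sum_ite_eq', Finset.mem_range]
    split_ifs with h
    · rfl
    · exact (hc0 k (by omega)).symm
  refine ⟨S0, ⟨hdeg, fun k => by rw [hS0]; exact hc k⟩, ?_⟩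
  ext k
  refine tendsto_nhds_unique (hP.2 k) ?_
  cases k with
  | zero =>
    simp only [sub_mul, coeff_sub, coeff_C_mul, coeff_X_mul_zero, hS0, zero_sub]
    refine (hx.mul (hc 0)).neg.congr' ?_
    filter_upwards [h] with a ha
    rw [ha]; simp [sub_mul]
  | succ k =>
    rw [sub_mul, coeff_sub, coeff_C_mul, coeff_X_mul, hS0, hS0]
    refine ((hc k).sub (hx.mul (hc (k + 1)))).congr' ?_
    filter_upwards [h] with a ha
    rw [ha, sub_mul, coeff_sub, coeff_C_mul, coeff_X_mul]

lemma conv_div_pow {α : Type*} {F : Filter α} [F.NeBot] {d : ℕ} {x : α → ℝ} {x0 : ℝ}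
    (hx : Tendsto x F (𝓝 x0)) (w : ℕ) : ∀ {P S : α → ℝ[X]} {P0 : ℝ[X]}, Conv F d P P0 →
    (∀ᶠ a in F, P a = (X - C (x a)) ^ w * S a) →
    ∃ S0, Conv F d S S0 ∧ P0 = (X - C x0) ^ w * S0 := by
  induction w with
  | zero =>
    intro P S P0 hP h
    refine ⟨P0, ⟨?_, fun k => (hP.2 k).congr' ?_⟩, by simp⟩
    · filter_upwards [hP.1, h] with a h1 h2
      rw [h2] at h1; simpa using h1
    · filter_upwards [h] with a h2
      rw [h2]; simp
  | succ w ih =>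
    intro P S P0 hP h
    obtain ⟨T0, hT, hPT⟩ := conv_div (S := fun a => (X - C (x a)) ^ w * S a) hP hx (by
      filter_upwards [h] with a ha
      rw [ha]; ring)
    obtain ⟨S0, hS, hTS⟩ := ih hT (S := S) (Eventually.of_forall fun a => rfl)
    exact ⟨S0, hS, by rw [hPT, hTS]; ring⟩

lemma conv_eval {α : Type*} {F : Filter α} {d : ℕ} {P : α → ℝ[X]} {P0 : ℝ[X]} [F.NeBot]
    (hP : Conv F d P P0) (y : ℝ) : Tendsto (fun a => (P a).eval y) F (𝓝 (P0.eval y)) := by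
  have h0 : P0.natDegree ≤ d := by
    rw [natDegree_le_iff_coeff_eq_zero]
    intro k hk
    refine tendsto_nhds_unique (hP.2 k) (tendsto_const_nhds.congr' ?_)
    filter_upwards [hP.1] with a ha
    exact (coeff_eq_zero_of_natDegree_lt (by omega)).symm
  rw [eval_eq_sum_range' (Nat.lt_succ_of_le h0)]
  refine (tendsto_finsetSum (Finset.range (d + 1)) fun k _ =>
    (hP.2 k).mul (tendsto_const_nhds (x := y ^ k))).congr' ?_
  filter_upwards [hP.1] with a ha
  rw [eval_eq_sum_range' (Nat.lt_succ_of_le ha)]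

lemma limit_fac {α : Type*} (F : Ultrafilter α) (d : ℕ) (B : ℝ) (ω : Comp) :
    ∀ (P : α → ℝ[X]) (P0 : ℝ[X]) (m : α → ℝ) (m0 : ℝ), Conv (F : Filter α) d P P0 →
    Tendsto m F (𝓝 m0) →
    (∀ᶠ a in (F : Filter α), ∃ L, ∃ Q : ℝ[X], L.map Prod.snd = ω ∧ wk L ∧
      (∀ p ∈ L, m a ≤ p.1 ∧ |p.1| ≤ B) ∧ (∀ y, 0 ≤ Q.eval y) ∧ P a = R L * Q) →
    ∃ L, ∃ Q : ℝ[X], L.map Prod.snd = ω ∧ wk L ∧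
      (∀ p ∈ L, m0 ≤ p.1) ∧ (∀ y, 0 ≤ Q.eval y) ∧ P0 = R L * Q := by
  induction ω with
  | nil =>
    intro P P0 m m0 hP hm h
    refine ⟨[], P0, rfl, by simp [wk], by simp, ?_, by simp⟩
    intro y
    refine ge_of_tendsto (conv_eval hP y) ?_
    filter_upwards [h] with a ⟨L, Q, hL, _, _, hQ, hPa⟩
    obtain rfl : L = [] := by simpa using hL
    rw [hPa]; simpa using hQ y
  | cons w ω ih =>
    intro P P0 m m0 hP hm h
    have h' : ∀ a, ∃ (x : ℝ) (S : ℝ[X]), (∃ L, ∃ Q : ℝ[X], L.map Prod.snd = w :: ω ∧ wk L ∧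
      (∀ p ∈ L, m a ≤ p.1 ∧ |p.1| ≤ B) ∧ (∀ y, 0 ≤ Q.eval y) ∧ P a = R L * Q) →
        P a = (X - C x) ^ (w : ℕ) * S ∧ m a ≤ x ∧ |x| ≤ B ∧
        ∃ L, ∃ Q : ℝ[X], L.map Prod.snd = ω ∧ wk L ∧
      (∀ p ∈ L, x ≤ p.1 ∧ |p.1| ≤ B) ∧ (∀ y, 0 ≤ Q.eval y) ∧ S = R L * Q := by
      intro a
      by_cases hh : ∃ L, ∃ Q : ℝ[X], L.map Prod.snd = w :: ω ∧ wk L ∧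
        (∀ p ∈ L, m a ≤ p.1 ∧ |p.1| ≤ B) ∧ (∀ y, 0 ≤ Q.eval y) ∧ P a = R L * Q
      · obtain ⟨L, Q, hL, hwk, hb, hQ, hPa⟩ := hh
        cases L with
        | nil => simp at hL
        | cons p L =>
          simp only [List.map_cons, List.cons.injEq] at hL
          obtain ⟨h1, h2⟩ := List.pairwise_cons.1 hwk
          refine ⟨p.1, R L * Q, fun _ => ⟨?_, (hb p (by simp)).1, (hb p (by simp)).2,
            L, Q, hL.2, h2, fun q hq => ⟨h1 q hq, (hb q (by simp [hq])).2⟩, hQ, rfl⟩⟩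
          rw [hPa, R_cons, hL.1, mul_assoc]
      · exact ⟨0, 0, fun h => absurd h hh⟩
    choose x S hxS using h'
    have hev := h.mono fun a => hxS a
    have hcomp : IsCompact (Set.Icc (-B) B) := isCompact_Icc
    obtain ⟨x0, -, hx0⟩ := hcomp.ultrafilter_le_nhds (F.map x) (by
      rw [le_principal_iff]
      change ∀ᶠ a in (F : Filter α), x a ∈ Set.Icc (-B) B
      filter_upwards [hev] with a ha
      exact abs_le.1 ha.2.2.1)
    have hx0 : Tendsto x F (𝓝 x0) := hx0
    obtain ⟨S0, hS, hPS⟩ := conv_div_pow hx0 (w : ℕ) hP (hev.mono fun a ha => ha.1)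
    obtain ⟨L, Q, hL, hwk, hb, hQ, hS0⟩ := ih S S0 x x0 hS hx0 (hev.mono fun a ha => ha.2.2.2)
    have hmx : m0 ≤ x0 := le_of_tendsto_of_tendsto hm hx0 (hev.mono fun a ha => ha.2.1)
    refine ⟨(x0, w) :: L, Q, by simp [hL], List.pairwise_cons.2 ⟨hb, hwk⟩, ?_, hQ, ?_⟩
    · intro p hp
      rcases List.mem_cons.1 hp with rfl | hp
      · exact hmx
      · exact hmx.trans (hb p hp)
    · rw [hPS, hS0, R_cons, mul_assoc]

/-! polyOf -/

lemma polyOf_coeff (d) (a : Fin d → ℝ) (k : ℕ) :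
    (polyOf d a).coeff k = if h : k < d then a ⟨k, h⟩ else if k = d then 1 else 0 := by
  simp only [polyOf, coeff_add, coeff_X_pow, finsetSum_coeff, coeff_C_mul]
  by_cases h1 : k < d
  · rw [dif_pos h1, if_neg (by omega), Finset.sum_eq_single ⟨k, h1⟩]
    · simp
    · intro b _ hb
      have : k ≠ b := fun h => hb (Fin.ext h.symm)
      simp [this]
    · simp
  · rw [dif_neg h1, Finset.sum_eq_zero, add_zero]
    intro b _
    have := b.2
    have : k ≠ b := by omega
    simp [this]

lemma polyOf_natDegree_le (d) (a : Fin d → ℝ) : (polyOf d a).natDegree ≤ d := by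
  rw [natDegree_le_iff_coeff_eq_zero]
  intro k hk
  rw [polyOf_coeff, dif_neg (by omega), if_neg (by omega)]

lemma polyOf_monic (d) (a : Fin d → ℝ) : (polyOf d a).Monic :=
  monic_of_natDegree_le_of_coeff_eq_one d (polyOf_natDegree_le d a) (by simp [polyOf_coeff])

lemma eq_polyOf (d) (P : ℝ[X]) (hP : P.Monic) (hd : P.natDegree = d) :
    polyOf d (fun i => P.coeff i) = P := by
  ext k
  rw [polyOf_coeff]
  split_ifs with h1 h2
  · rfl
  · subst h2; rw [← hd]; exact hP.symm
  · exact (coeff_eq_zero_of_natDegree_lt (by omega)).symm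

lemma polyOf_root_bound (d) (a : Fin d → ℝ) (x : ℝ) (hx : (polyOf d a).IsRoot x) :
    |x| ≤ 1 + ∑ i, |a i| := by
  by_contra hcon
  push Not at hcon
  have hs : 0 ≤ ∑ i, |a i| := Finset.sum_nonneg fun i _ => abs_nonneg _
  have h1 : 1 ≤ |x| := by linarith
  have h : x ^ d = - ∑ i : Fin d, a i * x ^ (i : ℕ) := by
    simp only [IsRoot, polyOf, eval_add, eval_pow, eval_X, eval_finsetSum, eval_mul, eval_C] at hx
    linarith
  cases d with
  | zero => simp at h
  | succ d =>
    have h2 : |x| ^ (d + 1) ≤ (∑ i, |a i|) * |x| ^ d := by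
      rw [← abs_pow, h, abs_neg, Finset.sum_mul]
      refine (Finset.abs_sum_le_sum_abs _ _).trans (Finset.sum_le_sum fun i _ => ?_)
      rw [abs_mul, abs_pow]
      have := i.2
      exact mul_le_mul_of_nonneg_left (pow_le_pow_right₀ h1 (by omega)) (abs_nonneg _)
    rw [pow_succ'] at h2
    have := le_of_mul_le_mul_right h2 (by positivity)
    linarith

lemma pos_of_no_root (Q : ℝ[X]) (hm : Q.Monic) (h : ∀ y, ¬ Q.IsRoot y) (y : ℝ) :
    0 ≤ Q.eval y := by
  by_contra hcon
  push Not at hcon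
  have hdeg : 0 < Q.degree := by
    by_contra hd
    have := eq_C_of_degree_le_zero (not_lt.1 hd)
    have h1 : Q.natDegree = 0 := by rw [this]; simp
    rw [Polynomial.Monic.natDegree_eq_zero hm] at h1
    rw [h1] at hcon; simp at hcon; linarith
  have ht := Q.tendsto_atTop_of_leadingCoeff_nonneg hdeg (by rw [hm.leadingCoeff]; norm_num)
  obtain ⟨z, hz1, hz2⟩ := ((ht.eventually_ge_atTop 0).and (eventually_ge_atTop y)).exists
  obtain ⟨c, _, hc⟩ := intermediate_value_Icc hz2 Q.continuous.continuousOn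
    (Set.mem_Icc.2 ⟨hcon.le, hz1⟩)
  exact h c hc

lemma closed_of_poset (d : ℕ) (Θ : Set Comp)
    (hsub : Θ ⊆ {ω : Comp | normC ω ≤ d ∧ normC ω % 2 = d % 2})
    (hΘ : ∀ ω ∈ Θ, ∀ ω' : Comp, cprec ω' ω → normC ω' ≤ d → ω' ∈ Θ) :
    IsClosed (⋃ ω ∈ Θ, Sset d ω) := by
  have hfin : Θ.Finite := (finite_norm d).subset fun ω h => (hsub h).1
  rw [isClosed_iff_ultrafilter]
  intro a F hF hU
  rw [Ultrafilter.finite_biUnion_mem_iff hfin] at hU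
  obtain ⟨ω, hω, hU⟩ := hU
  have hle : (F : Filter (Fin d → ℝ)) ≤ 𝓝 a := hF
  have hconv : Conv (F : Filter (Fin d → ℝ)) d (polyOf d) (polyOf d a) := by
    refine ⟨Eventually.of_forall (polyOf_natDegree_le d), fun k => ?_⟩
    have : Continuous fun b : Fin d → ℝ => (polyOf d b).coeff k := by
      simp only [polyOf_coeff]
      split_ifs <;> fun_prop
    exact (this.tendsto a).mono_left hle
  have hb : ∀ᶠ b : Fin d → ℝ in F, 1 + ∑ i, |b i| < 2 + ∑ i, |a i| := by
    apply hle
    have : Continuous fun b : Fin d → ℝ => 1 + ∑ i, |b i| := by fun_prop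
    exact (this.tendsto a).eventually_lt_const (by linarith)
  obtain ⟨L, Q, hL, hwk, -, hQ, hP⟩ := limit_fac F d (2 + ∑ i, |a i|) ω (polyOf d) (polyOf d a)
    (fun _ => -(2 + ∑ i, |a i|)) _ hconv tendsto_const_nhds (by
      filter_upwards [hb, hU] with b hb hbU
      obtain ⟨L, hL, hs, Q, hQ, hP⟩ := fac_of_pattern hbU
      refine ⟨L, Q, hL, hs.imp le_of_lt, ?_, pos_of_no_root Q ?_ hQ, hP⟩
      · intro p hp
        have hr : (polyOf d b).IsRoot p.1 := by
          rw [hP, root_mul, R_root]; exact Or.inl ⟨p, hp, rfl⟩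
        have := (polyOf_root_bound d b p.1 hr).trans hb.le
        exact ⟨(abs_le.1 this).1, this⟩
      · exact (R_monic L).of_mul_monic_left (hP ▸ polyOf_monic d b))
  have hP0 := (polyOf_monic d a).ne_zero
  have hQ0 : Q ≠ 0 := by rintro rfl; simp [hP] at hP0
  obtain ⟨M, hM, hc⟩ := collapse _ L Q le_rfl hwk hQ0 hQ
  rw [← hP] at hM
  rw [hL] at hc
  have hpat := pattern_of_fac hM
  obtain ⟨_, Q', _, hMe⟩ := hM
  have hnorm : normC (M.map Prod.snd) ≤ d := by
    rw [← R_natDegree]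
    exact (natDegree_le_of_dvd ⟨Q', hMe⟩ hP0).trans (polyOf_natDegree_le d a)
  exact Set.mem_biUnion (hΘ ω hω _ hc hnorm) hpat

/-! the converse -/

def CC (f : ℝ → ℝ[X]) : Prop := ∀ k, Continuous fun t => (f t).coeff k

lemma CC_const (P : ℝ[X]) : CC fun _ => P := fun _ => continuous_const

lemma CC_mul {f g} (hf : CC f) (hg : CC g) : CC fun t => f t * g t := by
  intro k
  simp only [coeff_mul]
  exact continuous_finsetSum _ fun p _ => (hf p.1).mul (hg p.2)

lemma CC_add {f g} (hf : CC f) (hg : CC g) : CC fun t => f t + g t := by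
  intro k
  simp only [coeff_add]
  exact (hf k).add (hg k)

lemma CC_C {c : ℝ → ℝ} (hc : Continuous c) : CC fun t => C (c t) := by
  intro k
  simp only [coeff_C]
  split_ifs
  · exact hc
  · exact continuous_const

lemma CC_pow {f} (hf : CC f) (n : ℕ) : CC fun t => f t ^ n := by
  induction n with
  | zero => simpa using CC_const 1
  | succ n ih => simpa only [pow_succ] using CC_mul ih hf

lemma step_mem (d : ℕ) (Θ : Set Comp) (hcl : IsClosed (⋃ ω ∈ Θ, Sset d ω))
    (f : ℝ → ℝ[X]) (hf : CC f) (hm : ∀ t, (f t).Monic) (hd : ∀ t, (f t).natDegree = d)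
    (ω ω' : Comp) (hω : ω ∈ Θ) (h : ∀ t, 0 < t → t < 1 → hasPattern (f t) ω)
    (h0 : hasPattern (f 0) ω') : ω' ∈ Θ := by
  let g : ℝ → Fin d → ℝ := fun t i => (f t).coeff i
  have hg : Continuous g := continuous_pi fun i => hf i
  have hge : ∀ t, polyOf d (g t) = f t := fun t => eq_polyOf d (f t) (hm t) (hd t)
  have hpre : IsClosed (g ⁻¹' (⋃ ω ∈ Θ, Sset d ω)) := hcl.preimage hg
  have hs : Set.Ioo (0 : ℝ) 1 ⊆ g ⁻¹' (⋃ ω ∈ Θ, Sset d ω) := by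
    intro t ht
    refine Set.mem_biUnion hω ?_
    show hasPattern (polyOf d (g t)) ω
    rw [hge]; exact h t ht.1 ht.2
  have := hpre.closure_subset_iff.2 hs
  rw [closure_Ioo (by norm_num)] at this
  have h1 := this (Set.left_mem_Icc.2 zero_le_one)
  simp only [Set.mem_preimage, Set.mem_iUnion] at h1
  obtain ⟨η, hη, hp⟩ := h1
  have hp : hasPattern (polyOf d (g 0)) η := hp
  rw [hge] at hp
  rw [pattern_unique h0 hp]; exact hη

lemma exists_above (ω : Comp) : ∀ m : ℝ, ∃ L, st L ∧ L.map Prod.snd = ω ∧ ∀ p ∈ L, m < p.1 := by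
  induction ω with
  | nil => intro m; exact ⟨[], by simp [st], rfl, by simp⟩
  | cons w ω ih =>
    intro m
    obtain ⟨L, h1, h2, h3⟩ := ih (m + 1)
    refine ⟨(m + 1, w) :: L, List.pairwise_cons.2 ⟨h3, h1⟩, by simp [h2], ?_⟩
    intro p hp
    rcases List.mem_cons.1 hp with rfl | hp
    · simp
    · have := h3 p hp; linarith

lemma exists_below (ω : Comp) : ∀ m : ℝ, ∃ L, st L ∧ L.map Prod.snd = ω ∧ ∀ p ∈ L, p.1 < m := by
  induction ω using List.reverseRecOn with
  | nil => intro m; exact ⟨[], by simp [st], rfl, by simp⟩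
  | append_singleton ω w ih =>
    intro m
    obtain ⟨L, h1, h2, h3⟩ := ih (m - 1)
    refine ⟨L ++ [(m - 1, w)], List.pairwise_append.2 ⟨h1, by simp, by simpa using h3⟩,
      by simp [h2], ?_⟩
    intro p hp
    rcases List.mem_append.1 hp with hp | hp
    · have := h3 p hp; linarith
    · obtain rfl := List.mem_singleton.1 hp
      simp

/-- positive quadratic -/
noncomputable def qd (t : ℝ) : ℝ[X] := X ^ 2 + C (t ^ 2)

lemma qd_monic (t) : (qd t).Monic := monic_X_pow_add_C _ (by norm_num)
lemma qd_deg (t) : (qd t).natDegree = 2 := natDegree_X_pow_add_C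
lemma qd_root {t : ℝ} (ht : t ≠ 0) (y) : ¬ (qd t).IsRoot y := by
  simp only [qd, IsRoot, eval_add, eval_pow, eval_X, eval_C]
  have : 0 < t ^ 2 := by positivity
  nlinarith [sq_nonneg y]
lemma qd_pow_root (n : ℕ) (y) : ¬ (qd 1 ^ n).IsRoot y := by
  intro h
  exact qd_root one_ne_zero y (by rw [IsRoot, eval_pow] at h; exact eq_zero_of_pow_eq_zero h)

lemma st_two {L1 L2} (M : List (ℝ × PNat)) (h1 : st L1) (h2 : st L2) (hM : st M)
    (b1 : ∀ p ∈ L1, p.1 < 0) (b2 : ∀ p ∈ L2, 1 < p.1) (bM : ∀ p ∈ M, 0 ≤ p.1 ∧ p.1 ≤ 1) :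
    st (L1 ++ (M ++ L2)) := by
  refine List.pairwise_append.2 ⟨h1, List.pairwise_append.2 ⟨hM, h2, ?_⟩, ?_⟩
  · intro p hp q hq
    exact (bM p hp).2.trans_lt (b2 q hq)
  · intro p hp q hq
    rcases List.mem_append.1 hq with hq | hq
    · exact (b1 p hp).trans_le (bM q hq).1
    · have := b1 p hp
      have := b2 q hq
      linarith

lemma one_step (d : ℕ) (Θ : Set Comp) (hcl : IsClosed (⋃ ω ∈ Θ, Sset d ω))
    (y x : Comp) (hy : y ∈ Θ) (hs : cstep y x) (hn : normC x ≤ d) (hp : normC x % 2 = d % 2) :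
    x ∈ Θ := by
  obtain ⟨n, hn⟩ : ∃ n, d = normC x + 2 * n := ⟨(d - normC x) / 2, by omega⟩
  rw [cstep_iff] at hs
  rcases hs with ⟨l1, a, b, l2, rfl, rfl⟩ | ⟨l1, l2, rfl, rfl⟩
  · obtain ⟨L1, s1, rfl, b1⟩ := exists_below l1 0
    obtain ⟨L2, s2, rfl, b2⟩ := exists_above l2 1
    have hmon : ∀ t : ℝ, (R (L1 ++ ([(0, a), (t, b)] ++ L2)) * qd 1 ^ n).Monic :=
      fun t => (R_monic _).mul ((qd_monic 1).pow n)
    refine step_mem d Θ hcl (fun t => R (L1 ++ ([(0, a), (t, b)] ++ L2)) * qd 1 ^ n)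
      ?_ hmon ?_ _ _ hy ?_ ?_
    · simp only [R_append, R_cons, R_nil, sub_eq_add_neg, ← C_neg]
      exact CC_mul (CC_mul (CC_const _) (CC_mul (CC_mul (CC_const _) (CC_mul
        (CC_pow (CC_add (CC_const _) (CC_C (by fun_prop))) _) (CC_const _))) (CC_const _)))
        (CC_const _)
    · intro t
      rw [(R_monic _).natDegree_mul ((qd_monic 1).pow n), R_natDegree, (qd_monic 1).natDegree_pow,
        qd_deg, hn]
      simp [normC]; ring
    · intro t h0 h1
      have := pattern_of_fac (P := R (L1 ++ ([(0, a), (t, b)] ++ L2)) * qd 1 ^ n)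
        (L := L1 ++ ([(0, a), (t, b)] ++ L2))
        ⟨st_two _ s1 s2 (by simp [st, h0]) b1 b2 (by simp [h0.le, h1.le]), _, qd_pow_root n, rfl⟩
      simpa using this
    · have := pattern_of_fac (P := R (L1 ++ ([(0, a), (0, b)] ++ L2)) * qd 1 ^ n)
        (L := L1 ++ ([(0, a + b)] ++ L2))
        ⟨st_two _ s1 s2 (by simp [st]) b1 b2 (by simp), _, qd_pow_root n, by
          simp only [R_append, R_cons, R_nil, PNat.add_coe, pow_add]; ring⟩
      simpa using this
  · obtain ⟨L1, s1, rfl, b1⟩ := exists_below l1 0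
    obtain ⟨L2, s2, rfl, b2⟩ := exists_above l2 1
    have hmon : ∀ t : ℝ, (qd t * qd 1 ^ n).Monic :=
      fun t => (qd_monic t).mul ((qd_monic 1).pow n)
    refine step_mem d Θ hcl (fun t => R (L1 ++ L2) * (qd t * qd 1 ^ n))
      ?_ (fun t => (R_monic _).mul (hmon t)) ?_ _ _ hy ?_ ?_
    · exact CC_mul (CC_const _) (CC_mul (CC_add (CC_const _) (CC_C (by fun_prop))) (CC_const _))
    · intro t
      rw [(R_monic _).natDegree_mul (hmon t), R_natDegree,
        (qd_monic t).natDegree_mul ((qd_monic 1).pow n), (qd_monic 1).natDegree_pow,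
        qd_deg, qd_deg, hn]
      simp [normC]; ring
    · intro t h0 h1
      have := pattern_of_fac (P := R (L1 ++ L2) * (qd t * qd 1 ^ n)) (L := L1 ++ ([] ++ L2))
        ⟨st_two _ s1 s2 (by simp [st]) b1 b2 (by simp), _, fun y hy => by
          rw [root_mul] at hy
          exact hy.elim (qd_root h0.ne' y) (qd_pow_root n y), rfl⟩
      simpa using this
    · have := pattern_of_fac (P := R (L1 ++ L2) * (qd 0 * qd 1 ^ n)) (L := L1 ++ ([(0, 2)] ++ L2))
        ⟨st_two _ s1 s2 (by simp [st]) b1 b2 (by simp), _, qd_pow_root n, by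
          simp [qd]; ring⟩
      simpa using this

lemma poset_of_closed (d : ℕ) (Θ : Set Comp)
    (hsub : Θ ⊆ {ω : Comp | normC ω ≤ d ∧ normC ω % 2 = d % 2})
    (hcl : IsClosed (⋃ ω ∈ Θ, Sset d ω)) (ω : Comp) (hω : ω ∈ Θ) (ω' : Comp)
    (h : cprec ω' ω) : normC ω' ≤ d → ω' ∈ Θ := by
  induction h with
  | refl => exact fun _ => hω
  | tail _ hs ih =>
    intro hn
    have h1 := cstep_norm hs
    have hb := ih (h1.1.trans hn)
    exact one_step d Θ hcl _ _ hb hs hn (h1.2 ▸ (hsub hb).2)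

end PatProof

/-- For `d ≥ 1` and `Θ ⊆ Ω_{⟨d]}`, the union `⋃_{ω ∈ Θ} S_d(ω)` is closed
in `ℝ^d` if and only if `Θ` is closed under `⪯` among compositions of norm at most `d`. -/
theorem union_isClosed_iff_closed_poset (d : ℕ) (hd : 1 ≤ d) (Θ : Set Comp)
    (hsub : Θ ⊆ {ω : Comp | normC ω ≤ d ∧ normC ω % 2 = d % 2}) :
    IsClosed (⋃ ω ∈ Θ, Sset d ω) ↔
      ∀ ω ∈ Θ, ∀ ω' : Comp, cprec ω' ω → normC ω' ≤ d → ω' ∈ Θ := by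
  exact ⟨fun h ω hω ω' hc => PatProof.poset_of_closed d Θ hsub h ω hω ω' hc,
    PatProof.closed_of_poset d Θ hsub⟩
end
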